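/- Let γ : ℝ → ℝ³ be a C^∞ curve with γ'(0) = 0, γ''(0) ≠ 0, dim span{γ''(0), γ'''(0)} = 2, and dim span{γ''(0), γ'''(0), γ''''(0)} = 3 (i.e. γ has type (2,3,4) at 0), and let δ : ℝ → ℝ³ be a C^∞ map with γ'(t) = t·δ(t) for all t. Then the tangent map-germ Tan(γ)(s,t) = γ(t) + s·δ(t) at (0,0) is diffeomorphic (right–left equivalent) to the swallowtail map-germ (u,x) ↦ (u, x³ + ux, (3/4)x⁴ + (1/2)ux²) at 0. -/

import Mathlib

open Filter Topology

/-- Two map-germs `f` at `a` and `g` at `b` are diffeomorphic (right-left equivalent):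
there are germs of `C^∞` diffeomorphisms `σ : (E, a) → (E, b)` and
`τ : (F, f a) → (F, g b)` with `g ∘ σ = τ ∘ f` as germs at `a`. -/
def GermEquiv {E F : Type*} [NormedAddCommGroup E] [NormedSpace ℝ E]
    [NormedAddCommGroup F] [NormedSpace ℝ F]
    (f : E → F) (a : E) (g : E → F) (b : E) : Prop :=
  ∃ σ σinv : E → E, ∃ τ τinv : F → F,
    σ a = b ∧ τ (f a) = g b ∧
    ContDiffAt ℝ (⊤ : ℕ∞) σ a ∧ ContDiffAt ℝ (⊤ : ℕ∞) σinv b ∧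
    ContDiffAt ℝ (⊤ : ℕ∞) τ (f a) ∧ ContDiffAt ℝ (⊤ : ℕ∞) τinv (g b) ∧
    (∀ᶠ x in 𝓝 a, σinv (σ x) = x) ∧ (∀ᶠ y in 𝓝 b, σ (σinv y) = y) ∧
    (∀ᶠ z in 𝓝 (f a), τinv (τ z) = z) ∧ (∀ᶠ w in 𝓝 (g b), τ (τinv w) = w) ∧
    (∀ᶠ x in 𝓝 a, g (σ x) = τ (f x))

section
open Filter Topology Set
open scoped ContDiff

theorem exists_kappa : ∃ κ : ℝ → ℝ, Function.HasTemperateGrowth κ ∧ ∀ z, 1 ≤ z → κ z = z⁻¹ := by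
  let ψ : ContDiffBump (0:ℝ) := ⟨1/4, 1/2, by norm_num, by norm_num⟩
  let κ : ℝ → ℝ := fun z => z⁻¹ * (1 - ψ z)
  have hout : ∀ z : ℝ, 1/2 ≤ |z| → κ z = z⁻¹ := by
    intro z hz
    have : ψ z = 0 := ψ.zero_of_le_dist (by simp only [dist_zero_right, Real.norm_eq_abs]; exact hz)
    simp [κ, this]
  have hin : ∀ z : ℝ, |z| ≤ 1/4 → κ z = 0 := by
    intro z hz
    have : ψ z = 1 := ψ.one_of_mem_closedBall (by simp only [Metric.mem_closedBall, dist_zero_right, Real.norm_eq_abs]; exact hz)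
    simp [κ, this]
  have hsm : ContDiff ℝ ∞ κ := by
    rw [contDiff_iff_contDiffAt]
    intro z
    by_cases hz : z = 0
    · subst hz
      have : κ =ᶠ[𝓝 0] fun _ => (0:ℝ) := by
        have : Metric.ball (0:ℝ) (1/4) ∈ 𝓝 (0:ℝ) := Metric.ball_mem_nhds _ (by norm_num)
        filter_upwards [this] with y hy
        apply hin
        simp at hy
        linarith
      exact contDiffAt_const.congr_of_eventuallyEq this
    · exact (contDiffAt_inv ℝ hz).mul (contDiffAt_const.sub ψ.contDiffAt)
  refine ⟨κ, ⟨hsm, fun n => ?_⟩, fun z hz => hout z (by rw [abs_of_pos] <;> linarith)⟩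
  have hc : Continuous (fun z => ‖iteratedFDeriv ℝ n κ z‖) :=
    (hsm.continuous_iteratedFDeriv (by exact_mod_cast le_top)).norm
  obtain ⟨C, hC⟩ := (isCompact_Icc (a := (-1:ℝ)) (b := 1)).exists_bound_of_continuousOn hc.continuousOn
  refine ⟨0, max C n.factorial, fun z => ?_⟩
  simp only [pow_zero, mul_one]
  by_cases hz : z ∈ Icc (-1:ℝ) 1
  · have := hC z hz
    simp at this
    exact le_max_of_le_left this
  · apply le_max_of_le_right
    have hz1 : 1 < |z| := by
      by_contra h
      exact hz (abs_le.mp (not_lt.mp h))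
    have hev : κ =ᶠ[𝓝 z] fun y => y⁻¹ := by
      have : {y : ℝ | 1 < |y|} ∈ 𝓝 z := (isOpen_lt continuous_const continuous_abs).mem_nhds hz1
      filter_upwards [this] with y hy
      have hy' : 1 < |y| := hy
      exact hout y (by linarith)
    rw [norm_iteratedFDeriv_eq_norm_iteratedDeriv, hev.iteratedDeriv_eq, iteratedDeriv_eq_iterate]
    have := congrFun (iter_deriv_inv' (𝕜 := ℝ) n) z
    rw [this, norm_mul, norm_mul]
    simp only [norm_pow, norm_neg, norm_one, one_pow, one_mul, norm_natCast, norm_zpow]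
    have h1 : ‖z‖ ^ (-1 - (n:ℤ)) ≤ 1 := by
      apply zpow_le_one_of_nonpos₀ (by simpa using hz1.le)
      omega
    have h2 : (0:ℝ) ≤ n.factorial := by positivity
    nlinarith

end

section
open Filter Topology Set
open scoped ContDiff

/-- cofactor coefficients of the inverse of a quadratic modulo a quartic -/
def ucoef (a b c α β γ : ℝ) : Fin 4 → ℝ :=
  ![γ * ((γ - α*a) * (γ - α*a) - (-α*b-β*a) * β)
      - (-α*b) * (β * (γ - α*a) - (-α*b-β*a) * α) + (-α*c-β*b) * (β * β - (γ-α*a) * α),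
    -(β * ((γ - α*a) * (γ - α*a) - (-α*b-β*a) * β)
      - (-α*b) * (α * (γ - α*a)) + (-α*c-β*b) * (α * β)),
    β * (β * (γ - α*a) - (-α*b-β*a) * α) - γ * (α * (γ - α*a)) + (-α*c-β*b) * (α * α),
    -(β * (β * β - (γ - α*a) * α) - γ * (α * β) + (-α*b) * (α * α))]

def mres (a b c α β γ : ℝ) : ℝ :=
  γ * ucoef a b c α β γ 0 + (-α*c) * ucoef a b c α β γ 2 + (-β*c) * ucoef a b c α β γ 3

theorem ucoef_eval (x H α β γ : ℝ) :
    let u := ucoef (H-2*x^2) (-2*x*H) (x^2*(x^2+H)) α β γ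
    (u 0 + u 1 * x + u 2 * x^2 + u 3 * x^3) * (α*x^2+β*x+γ) =
      mres (H-2*x^2) (-2*x*H) (x^2*(x^2+H)) α β γ := by
  simp [ucoef, mres]
  ring

theorem ucoef_eval_deriv (x H α β γ : ℝ) :
    let u := ucoef (H-2*x^2) (-2*x*H) (x^2*(x^2+H)) α β γ
    (u 1 + 2 * u 2 * x + 3 * u 3 * x^2) * (α*x^2+β*x+γ) +
    (u 0 + u 1 * x + u 2 * x^2 + u 3 * x^3) * (2*α*x+β) = 0 := by
  simp [ucoef]
  ring

theorem mres_eval (x H α β γ : ℝ) :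
    mres (H-2*x^2) (-2*x*H) (x^2*(x^2+H)) α β γ =
    (α*x^2+β*x+γ)^2 * ((α*x^2-β*x+γ-α*H)^2 + (β-2*α*x)^2*H) := by
  simp [ucoef, mres]
  ring

theorem quad_lower {α β γ ε : ℝ} (hα : 0 < α) (hα4 : α ≤ 4) (hε : 0 < ε)
    (hd : 4 * ε^2 ≤ 4*α*γ - β^2) (T : ℝ) : ε^2/4 ≤ α*T^2+β*T+γ := by
  have h1 : ε^2 ≤ α * (α*T^2+β*T+γ) := by nlinarith [sq_nonneg (2*α*T+β)]
  have h2 : 0 < α*T^2+β*T+γ := by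
    by_contra h
    have : α * (α*T^2+β*T+γ) ≤ 0 := mul_nonpos_of_nonneg_of_nonpos hα.le (not_lt.mp h)
    nlinarith [pow_pos hε 2]
  nlinarith

theorem mres_lower {α β γ ε : ℝ} (hα : 0 < α) (hα4 : α ≤ 4) (hε : 0 < ε)
    (hd : 4 * ε^2 ≤ 4*α*γ - β^2) (x H : ℝ) (hH : H ≤ ε^2/32) :
    ε^8/1024 ≤ mres (H-2*x^2) (-2*x*H) (x^2*(x^2+H)) α β γ := by
  rw [mres_eval]
  have hD := quad_lower hα hα4 hε hd
  have e2 : 0 < ε^2/4 := by positivity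
  have hb : ε^4/64 ≤ (α*x^2-β*x+γ-α*H)^2 + (β-2*α*x)^2*H := by
    rcases le_total H 0 with h | h
    · have key : (α*x^2-β*x+γ-α*H)^2 + (β-2*α*x)^2*H =
        (α*(-x+√(-H))^2+β*(-x+√(-H))+γ) * (α*(-x-√(-H))^2+β*(-x-√(-H))+γ) := by
        have hs : √(-H)^2 = -H := Real.sq_sqrt (by linarith)
        have hH2 : H = -√(-H)^2 := by linarith
        generalize √(-H) = s at *
        rw [hH2]; ring
      rw [key]
      have := mul_le_mul (hD (-x+√(-H))) (hD (-x-√(-H))) e2.le (e2.le.trans (hD _))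
      have e4 : 0 ≤ ε^4 := by positivity
      nlinarith
    · have h1 := hD (-x)
      have h2 : ε^2/8 ≤ α*x^2-β*x+γ-α*H := by nlinarith
      have h3 := pow_le_pow_left₀ (by positivity) h2 2
      have h4 : 0 ≤ (β-2*α*x)^2*H := by positivity
      nlinarith
  have h5 := pow_le_pow_left₀ e2.le (hD x) 2
  have := mul_le_mul h5 hb (by positivity) (by positivity)
  calc ε^8/1024 = (ε^2/4)^2 * (ε^4/64) := by ring
    _ ≤ _ := this

/-- the regularised inverse at scale `N` -/
def kapN (κ : ℝ → ℝ) (N z : ℝ) : ℝ := N * κ (N * z)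

theorem kapN_eq {κ : ℝ → ℝ} (hκ : ∀ z, 1 ≤ z → κ z = z⁻¹) {N z : ℝ} (hN : 0 < N) (h : 1 ≤ N * z) :
    kapN κ N z = z⁻¹ := by
  rw [kapN, hκ _ h, mul_inv, ← mul_assoc, mul_inv_cancel₀ hN.ne', one_mul]

def xt (κ : ℝ → ℝ) (a b c n : ℝ) : ℝ :=
  -b*(a^2+12*c) * kapN κ (2^14*n^6) (2*a^3-8*a*c+9*b^2)

def Et (κ : ℝ → ℝ) (a b c α β γ n : ℝ) : ℝ :=
  kapN κ (4*n^2) (α*(xt κ a b c n)^2+β*(xt κ a b c n)+γ)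

def B1 (κ : ℝ → ℝ) (a b c α β γ n : ℝ) : ℝ :=
  -(2*α*xt κ a b c n + β) * (Et κ a b c α β γ n)^2

def mkap (κ : ℝ → ℝ) (a b c α β γ n : ℝ) : ℝ :=
  kapN κ (1024*n^8) (mres a b c α β γ)

def kern (κ : ℝ → ℝ) (a b c α β γ n : ℝ) : Fin 4 → ℝ :=
  ![ucoef a b c α β γ 0 * mkap κ a b c α β γ n + (1 - mres a b c α β γ * mkap κ a b c α β γ n) *
      (Et κ a b c α β γ n - xt κ a b c n * B1 κ a b c α β γ n),
    ucoef a b c α β γ 1 * mkap κ a b c α β γ n + (1 - mres a b c α β γ * mkap κ a b c α β γ n) *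
      B1 κ a b c α β γ n,
    ucoef a b c α β γ 2 * mkap κ a b c α β γ n, ucoef a b c α β γ 3 * mkap κ a b c α β γ n]

theorem kern_eval {κ : ℝ → ℝ} (hκ : ∀ z, 1 ≤ z → κ z = z⁻¹) (x H α β γ n : ℝ) (hn : 1 ≤ n)
    (hα : 0 < α) (hα4 : α ≤ 4) (hd : 4 ≤ n^2*(4*α*γ - β^2)) :
    let r := kern κ (H-2*x^2) (-2*x*H) (x^2*(x^2+H)) α β γ n
    r 0 + r 1 * x + r 2 * x^2 + r 3 * x^3 = (α*x^2+β*x+γ)⁻¹ ∧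
    r 1 + 2 * r 2 * x + 3 * r 3 * x^2 = -(2*α*x+β) * ((α*x^2+β*x+γ)⁻¹)^2 := by
  intro r
  obtain ⟨ε, hε, hεn⟩ : ∃ ε : ℝ, 0 < ε ∧ n * ε = 1 := ⟨n⁻¹, by positivity, by field_simp⟩
  have hd' : 4 * ε^2 ≤ 4*α*γ - β^2 := by
    have h1 := mul_le_mul_of_nonneg_left hd (sq_nonneg ε)
    have h2 : ε^2 * (n^2*(4*α*γ - β^2)) = (n*ε)^2*(4*α*γ - β^2) := by ring
    rw [h2, hεn] at h1
    linarith
  have hn0 : 0 < n := by linarith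
  have hD := quad_lower hα hα4 hε hd'
  have hDx := hD x
  have hDpos : 0 < α*x^2+β*x+γ := lt_of_lt_of_le (by positivity) hDx
  have hu := ucoef_eval x H α β γ
  have hu' := ucoef_eval_deriv x H α β γ
  set a := H-2*x^2 with ha
  set b := -2*x*H with hb
  set c := x^2*(x^2+H) with hc
  set m := mres a b c α β γ with hm
  set K := mkap κ a b c α β γ n with hK
  simp only at hu hu'
  have main : (m * K = 1) ∨ (xt κ a b c n = x ∧ Et κ a b c α β γ n = (α*x^2+β*x+γ)⁻¹) := by
    rcases le_total H (ε^2/32) with h | h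
    · left
      have hml : ε^8/1024 ≤ m := mres_lower hα hα4 hε hd' x H h
      have hmpos : 0 < m := lt_of_lt_of_le (by positivity) hml
      have : K = m⁻¹ := by
        apply kapN_eq hκ (by positivity)
        calc (1:ℝ) = (n*ε)^8 := by rw [hεn]; norm_num
          _ = 1024*n^8 * (ε^8/1024) := by ring
          _ ≤ _ := by gcongr
      rw [this, mul_inv_cancel₀ hmpos.ne']
    · right
      have hHpos : 0 < H := lt_of_lt_of_le (by positivity) h
      have hΔ : 2*a^3-8*a*c+9*b^2 = 2*H*(H+4*x^2)^2 := by rw [ha, hb, hc]; ring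
      have hx : xt κ a b c n = x := by
        have : kapN κ (2^14*n^6) (2*a^3-8*a*c+9*b^2) = (2*a^3-8*a*c+9*b^2)⁻¹ := by
          apply kapN_eq hκ (by positivity)
          rw [hΔ]
          calc (1:ℝ) = (n*ε)^6 := by rw [hεn]; norm_num
            _ = 2^14*n^6 * (2 * (ε^2/32) * (ε^2/32+4*0)^2) := by ring
            _ ≤ _ := by gcongr; positivity
        rw [xt, this, hΔ]
        have h12 : a^2+12*c = (H+4*x^2)^2 := by rw [ha, hc]; ring
        rw [h12, hb]
        have : H+4*x^2 ≠ 0 := by positivity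
        field_simp
      refine ⟨hx, ?_⟩
      rw [Et, hx]
      apply kapN_eq hκ (by positivity)
      calc (1:ℝ) = (n*ε)^2 := by rw [hεn]; norm_num
        _ = 4*n^2 * (ε^2/4) := by ring
        _ ≤ _ := by gcongr
  set u := ucoef a b c α β γ
  have r0 : r 0 = u 0 * K + (1 - m*K) * (Et κ a b c α β γ n - xt κ a b c n * B1 κ a b c α β γ n) := rfl
  have r1 : r 1 = u 1 * K + (1 - m*K) * B1 κ a b c α β γ n := rfl
  have r2 : r 2 = u 2 * K := rfl
  have r3 : r 3 = u 3 * K := rfl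
  have hB : B1 κ a b c α β γ n = -(2*α*xt κ a b c n + β) * (Et κ a b c α β γ n)^2 := rfl
  rw [r0, r1, r2, r3, hB]
  set D := α*x^2+β*x+γ
  have e1 : u 0 + u 1 * x + u 2 * x^2 + u 3 * x^3 = m * D⁻¹ := by
    rw [← hu]; field_simp
  have e2 : u 1 + 2 * u 2 * x + 3 * u 3 * x^2 = -(m * (2*α*x+β) * (D⁻¹)^2) := by
    rw [e1] at hu'
    have : u 1 + 2 * u 2 * x + 3 * u 3 * x^2 = -(m * D⁻¹ * (2*α*x+β)) * D⁻¹ := by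
      rw [eq_mul_inv_iff_mul_eq₀ hDpos.ne']; linarith
    rw [this]; ring
  rcases main with h | ⟨h, h'⟩
  · constructor
    · linear_combination K * e1 + (D⁻¹ - (Et κ a b c α β γ n - xt κ a b c n * (-(2*α*xt κ a b c n + β) * (Et κ a b c α β γ n)^2)) - x*(-(2*α*xt κ a b c n + β) * (Et κ a b c α β γ n)^2)) * h
    · linear_combination K * e2 + (-(2*α*x+β) * (D⁻¹)^2 - (-(2*α*xt κ a b c n + β) * (Et κ a b c α β γ n)^2)) * h
  · rw [h, h']
    constructor
    · linear_combination K * e1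
    · linear_combination K * e2

theorem kern_temperate {E : Type*} [NormedAddCommGroup E] [NormedSpace ℝ E] {κ : ℝ → ℝ}
    (hκ : κ.HasTemperateGrowth) {a b c α β γ n : E → ℝ}
    (ha : a.HasTemperateGrowth) (hb : b.HasTemperateGrowth) (hc : c.HasTemperateGrowth)
    (hα : α.HasTemperateGrowth) (hβ : β.HasTemperateGrowth) (hγ : γ.HasTemperateGrowth)
    (hn : n.HasTemperateGrowth) (i : Fin 4) :
    Function.HasTemperateGrowth (fun p => kern κ (a p) (b p) (c p) (α p) (β p) (γ p) (n p) i) := by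
  have hu : ∀ i, Function.HasTemperateGrowth (fun p => ucoef (a p) (b p) (c p) (α p) (β p) (γ p) i) := by
    intro i
    fin_cases i <;> simp [ucoef] <;> fun_prop
  have h0 := hu 0
  have h1 := hu 1
  have h2 := hu 2
  have h3 := hu 3
  have hk : ∀ {N z : E → ℝ}, N.HasTemperateGrowth → z.HasTemperateGrowth →
      Function.HasTemperateGrowth (fun p => kapN κ (N p) (z p)) := by
    intro N z hN hz
    unfold kapN
    have : Function.HasTemperateGrowth (fun p => κ (N p * z p)) := hκ.comp (hN.mul hz)
    fun_prop
  have hm : Function.HasTemperateGrowth (fun p => mres (a p) (b p) (c p) (α p) (β p) (γ p)) := by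
    unfold mres; fun_prop
  have hx : Function.HasTemperateGrowth (fun p => xt κ (a p) (b p) (c p) (n p)) := by
    unfold xt
    have : Function.HasTemperateGrowth (fun p => kapN κ (2^14*(n p)^6) (2*(a p)^3-8*a p*c p+9*(b p)^2)) :=
      hk (by fun_prop) (by fun_prop)
    fun_prop
  have hE : Function.HasTemperateGrowth (fun p => Et κ (a p) (b p) (c p) (α p) (β p) (γ p) (n p)) := by
    unfold Et
    exact hk (by fun_prop) (by fun_prop)
  have hB : Function.HasTemperateGrowth (fun p => B1 κ (a p) (b p) (c p) (α p) (β p) (γ p) (n p)) := by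
    unfold B1; fun_prop
  have hK : Function.HasTemperateGrowth (fun p => mkap κ (a p) (b p) (c p) (α p) (β p) (γ p) (n p)) := by
    unfold mkap
    exact hk (by fun_prop) hm
  fin_cases i <;> simp [kern] <;> fun_prop

abbrev R4 := Fin 4 → ℝ

theorem kernel_exists : ∃ G : Fin 4 → R4 × R4 → ℝ, (∀ i, (G i).HasTemperateGrowth) ∧
    ∀ x H e α β γ n : ℝ, 1 ≤ n → 0 < α → α ≤ 4 → 4 ≤ n^2*(4*α*γ - β^2) →
    let r : Fin 4 → ℝ := fun i => G i (![H-2*x^2, -2*x*H, x^2*(x^2+H), e], ![α, β, γ, n])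
    r 0 + r 1 * x + r 2 * x^2 + r 3 * x^3 = (α*(x-e)^2+β*(x-e)+γ)⁻¹ ∧
    r 1 + 2 * r 2 * x + 3 * r 3 * x^2 = -(2*α*(x-e)+β) * ((α*(x-e)^2+β*(x-e)+γ)⁻¹)^2 := by
  obtain ⟨κ, hκ, hκ1⟩ := exists_kappa
  have h1 : ∀ j : Fin 4, Function.HasTemperateGrowth (fun p : R4 × R4 => p.1 j) := fun j =>
    ((ContinuousLinearMap.proj (R := ℝ) (φ := fun _ : Fin 4 => ℝ) j).comp
      (ContinuousLinearMap.fst ℝ R4 R4)).hasTemperateGrowth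
  have h2 : ∀ j : Fin 4, Function.HasTemperateGrowth (fun p : R4 × R4 => p.2 j) := fun j =>
    ((ContinuousLinearMap.proj (R := ℝ) (φ := fun _ : Fin 4 => ℝ) j).comp
      (ContinuousLinearMap.snd ℝ R4 R4)).hasTemperateGrowth
  have a0 := h2 0
  have a1 := h2 1
  have a2 := h2 2
  have a3 := h2 3
  have b3 := h1 3
  refine ⟨fun i p => kern κ (p.1 0) (p.1 1) (p.1 2) (p.2 0) (p.2 1 - 2*p.2 0*p.1 3)
    (p.2 2 - p.2 1 * p.1 3 + p.2 0 * (p.1 3)^2) (p.2 3) i, fun i => ?_, ?_⟩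
  · exact kern_temperate hκ (h1 0) (h1 1) (h1 2) a0 (by fun_prop) (by fun_prop) a3 i
  · intro x H e α β γ n hn hα hα4 hd r
    have := kern_eval hκ1 x H α (β-2*α*e) (γ-β*e+α*e^2) n hn hα hα4 (by
      convert hd using 2; ring)
    have e1 : α*x^2+(β-2*α*e)*x+(γ-β*e+α*e^2) = α*(x-e)^2+β*(x-e)+γ := by ring
    have e2 : 2*α*x+(β-2*α*e) = 2*α*(x-e)+β := by ring
    rw [e1, e2] at this
    exact this

end

section
open Filter Topology Set
open scoped ContDiff
open MeasureTheory

theorem temperate_fderiv {E F : Type*} [NormedAddCommGroup E] [NormedSpace ℝ E]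
    [NormedAddCommGroup F] [NormedSpace ℝ F] {f : E → F} (hf : f.HasTemperateGrowth) :
    Function.HasTemperateGrowth (fderiv ℝ f) := by
  refine ⟨hf.1.fderiv_right (by simp), fun n => ?_⟩
  obtain ⟨k, C, h⟩ := hf.2 (n+1)
  refine ⟨k, C, fun x => ?_⟩
  have := h x
  rw [iteratedFDeriv_succ_eq_comp_right, Function.comp_apply, LinearIsometryEquiv.norm_map] at this
  exact this

theorem temperate_bound {E F : Type*} [NormedAddCommGroup E] [NormedSpace ℝ E]
    [NormedAddCommGroup F] [NormedSpace ℝ F] {f : E → F} (hf : f.HasTemperateGrowth) :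
    ∃ (k : ℕ) (C : ℝ), 0 ≤ C ∧ ∀ x, ‖f x‖ ≤ C * (1 + ‖x‖)^k := by
  obtain ⟨k, C, hC, h⟩ := hf.norm_iteratedFDeriv_le_uniform 0
  exact ⟨k, C, hC, fun x => by simpa using h 0 le_rfl x⟩

section
variable {E V : Type} [NormedAddCommGroup E] [NormedSpace ℝ E]
  [NormedAddCommGroup V] [NormedSpace ℝ V]
  {Ω : Type} [MeasurableSpace Ω] {μ : Measure Ω} {w : Ω → ℝ} {p : Ω → V}

theorem param_bound (F : Type) [NormedAddCommGroup F] [NormedSpace ℝ F] {G : E × V → F}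
    (hG : G.HasTemperateGrowth) (r : ℝ) (hr : 0 ≤ r) : ∃ (k : ℕ) (C : ℝ), 0 ≤ C ∧ ∀ x v, ‖x‖ ≤ r →
      ‖G (x, v)‖ ≤ C * (1 + ‖v‖)^k := by
  obtain ⟨k, C, hC, h⟩ := temperate_bound hG
  refine ⟨k, C * (1+r)^k, by positivity, fun x v hx => (h _).trans ?_⟩
  rw [mul_assoc, ← mul_pow]
  gcongr
  rw [Prod.norm_mk]
  have := norm_nonneg v
  have := norm_nonneg x
  rcases max_cases ‖x‖ ‖v‖ with h | h <;> rw [h.1] <;> nlinarith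

theorem param_integrable (F : Type) [NormedAddCommGroup F] [NormedSpace ℝ F] {G : E × V → F}
    (hG : G.HasTemperateGrowth) (hw : AEStronglyMeasurable w μ) (hp : AEStronglyMeasurable p μ)
    (hi : ∀ M : ℕ, Integrable (fun o => |w o| * (1+‖p o‖)^M) μ) (x : E) :
    Integrable (fun o => w o • G (x, p o)) μ := by
  obtain ⟨k, C, hC, h⟩ := param_bound F hG ‖x‖ (norm_nonneg _)
  refine ((hi k).const_mul C).mono' (hw.smul ?_) (ae_of_all _ fun o => ?_)
  · exact (hG.1.continuous.comp (Continuous.prodMk_right x)).comp_aestronglyMeasurable hp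
  · rw [norm_smul, Real.norm_eq_abs]
    have := h x (p o) le_rfl
    have h0 := abs_nonneg (w o)
    nlinarith

theorem param_hasFDerivAt (F : Type) [NormedAddCommGroup F] [NormedSpace ℝ F] {G : E × V → F}
    (hG : G.HasTemperateGrowth) (hw : AEStronglyMeasurable w μ) (hp : AEStronglyMeasurable p μ)
    (hi : ∀ M : ℕ, Integrable (fun o => |w o| * (1+‖p o‖)^M) μ) (x : E) :
    HasFDerivAt (fun x => ∫ o, w o • G (x, p o) ∂μ)
      (∫ o, w o • (fderiv ℝ G (x, p o)).comp (ContinuousLinearMap.inl ℝ E V) ∂μ) x := by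
  have hG' : Function.HasTemperateGrowth
      (fun z => (fderiv ℝ G z).comp (ContinuousLinearMap.inl ℝ E V)) :=
    (((ContinuousLinearMap.compL ℝ E (E × V) F).flip
      (ContinuousLinearMap.inl ℝ E V)).hasTemperateGrowth).comp (temperate_fderiv hG)
  obtain ⟨k, C, hC, h⟩ := param_bound _ hG' (‖x‖+1) (by positivity)
  refine hasFDerivAt_integral_of_dominated_of_fderiv_le (s := Metric.ball x 1)
    (F' := fun x o => w o • (fderiv ℝ G (x, p o)).comp (ContinuousLinearMap.inl ℝ E V))
    (bound := fun o => C * (|w o| * (1+‖p o‖)^k)) (Metric.ball_mem_nhds _ one_pos)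
    (Eventually.of_forall fun y => (param_integrable F hG hw hp hi y).aestronglyMeasurable)
    (param_integrable F hG hw hp hi x)
    (param_integrable _ hG' hw hp hi x).aestronglyMeasurable ?_ ((hi k).const_mul C) ?_
  · refine ae_of_all _ fun o y hy => ?_
    rw [norm_smul, Real.norm_eq_abs]
    have hy' : ‖y‖ ≤ ‖x‖+1 := by
      have h1 : ‖y - x‖ < 1 := by simpa [dist_eq_norm] using hy
      have := norm_le_norm_add_norm_sub x y
      rw [norm_sub_rev] at this
      linarith [norm_sub_rev x y]
    have := h y (p o) hy'
    have h0 := abs_nonneg (w o)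
    nlinarith
  · refine ae_of_all _ fun o y hy => ?_
    apply HasFDerivAt.const_smul
    have h1 : HasFDerivAt G (fderiv ℝ G (y, p o)) (y, p o) :=
      (hG.1.differentiable (by simp) _).hasFDerivAt
    exact h1.comp y (hasFDerivAt_prodMk_left y (p o))

theorem param_contDiff (hw : AEStronglyMeasurable w μ) (hp : AEStronglyMeasurable p μ)
    (hi : ∀ M : ℕ, Integrable (fun o => |w o| * (1+‖p o‖)^M) μ) (n : ℕ) :
    ∀ (F : Type) [NormedAddCommGroup F] [NormedSpace ℝ F] (G : E × V → F)
    (_ : G.HasTemperateGrowth), ContDiff ℝ n (fun x => ∫ o, w o • G (x, p o) ∂μ) := by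
  induction n with
  | zero =>
    intro F _ _ G hG
    rw [Nat.cast_zero, contDiff_zero, continuous_iff_continuousAt]
    exact fun x => (param_hasFDerivAt F hG hw hp hi x).continuousAt
  | succ n ih =>
    intro F _ _ G hG
    have hG' : Function.HasTemperateGrowth
      (fun z => (fderiv ℝ G z).comp (ContinuousLinearMap.inl ℝ E V)) :=
    (((ContinuousLinearMap.compL ℝ E (E × V) F).flip
      (ContinuousLinearMap.inl ℝ E V)).hasTemperateGrowth).comp (temperate_fderiv hG)
    have hd := fun x => param_hasFDerivAt F hG hw hp hi x
    rw [Nat.cast_succ, contDiff_succ_iff_fderiv]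
    refine ⟨fun x => (hd x).differentiableAt, by simp, ?_⟩
    have : fderiv ℝ (fun x => ∫ o, w o • G (x, p o) ∂μ) = fun x =>
      ∫ o, w o • (fderiv ℝ G (x, p o)).comp (ContinuousLinearMap.inl ℝ E V) ∂μ :=
      funext fun x => (hd x).fderiv
    rw [this]
    exact ih _ (fun z => (fderiv ℝ G z).comp (ContinuousLinearMap.inl ℝ E V)) hG'

theorem param_smooth (hw : AEStronglyMeasurable w μ) (hp : AEStronglyMeasurable p μ)
    (hi : ∀ M : ℕ, Integrable (fun o => |w o| * (1+‖p o‖)^M) μ)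
    (F : Type) [NormedAddCommGroup F] [NormedSpace ℝ F] (G : E × V → F)
    (hG : G.HasTemperateGrowth) : ContDiff ℝ ∞ (fun x => ∫ o, w o • G (x, p o) ∂μ) :=
  contDiff_infty.2 fun n => param_contDiff hw hp hi n F G hG

end

/-- cut-off of a smooth function -/
theorem exists_cutoff {F : Type} [NormedAddCommGroup F] [NormedSpace ℝ F] (g : ℝ → F)
    (hg : ContDiff ℝ ∞ g) : ∃ g' : ℝ → F, g'.HasTemperateGrowth ∧ ∀ t, |t| ≤ 1 → g' t = g t := by
  let ψ : ContDiffBump (0:ℝ) := ⟨1, 2, by norm_num, by norm_num⟩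
  refine ⟨fun t => ψ t • g t, ?_, fun t ht => ?_⟩
  · apply HasCompactSupport.hasTemperateGrowth
    · exact ψ.hasCompactSupport.smul_right
    · exact ψ.contDiff.smul hg
  · have : ψ t = 1 := ψ.one_of_mem_closedBall
      (by simp only [Metric.mem_closedBall, dist_zero_right, Real.norm_eq_abs]; exact ht)
    simp [this]

theorem temperate_deriv {F : Type} [NormedAddCommGroup F] [NormedSpace ℝ F] {g : ℝ → F}
    (hg : g.HasTemperateGrowth) : Function.HasTemperateGrowth (deriv g) := by
  have : deriv g = fun t => ContinuousLinearMap.apply ℝ F (1:ℝ) (fderiv ℝ g t) := by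
    ext t; simp
  rw [this]
  exact (ContinuousLinearMap.hasTemperateGrowth _).comp (temperate_fderiv hg)

/-- Hadamard lemma, local form. -/
theorem hadamard {F : Type} [NormedAddCommGroup F] [NormedSpace ℝ F] [CompleteSpace F] (g : ℝ → F)
    (hg : ContDiff ℝ ∞ g) : ∃ k : ℝ → F, ContDiff ℝ ∞ k ∧ k 0 = deriv g 0 ∧
      ∀ᶠ t in 𝓝 (0:ℝ), g t = g 0 + t • k t := by
  obtain ⟨g', hg', heq⟩ := exists_cutoff g hg
  have hev : g =ᶠ[𝓝 0] g' := by
    filter_upwards [Metric.ball_mem_nhds (0:ℝ) one_pos] with t ht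
    exact (heq t (by simpa using (Metric.mem_ball.1 ht).le)).symm
  let G : ℝ × ℝ → F := fun q => deriv g' (q.1 * q.2)
  have h1 : Function.HasTemperateGrowth (fun p : ℝ × ℝ => p.1) :=
    (ContinuousLinearMap.fst ℝ ℝ ℝ).hasTemperateGrowth
  have h2 : Function.HasTemperateGrowth (fun p : ℝ × ℝ => p.2) :=
    (ContinuousLinearMap.snd ℝ ℝ ℝ).hasTemperateGrowth
  have hG : G.HasTemperateGrowth := (temperate_deriv hg').comp (h1.mul h2)
  have hs := param_smooth (μ := volume.restrict (Ioc (0:ℝ) 1)) (w := fun _ => (1:ℝ)) (p := fun s : ℝ => s)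
    aestronglyMeasurable_const aestronglyMeasurable_id (by
      intro M
      have : Continuous (fun s : ℝ => |(1:ℝ)| * (1+‖s‖)^M) := by fun_prop
      exact (this.integrableOn_Icc (a := 0) (b := 1)).mono_set Ioc_subset_Icc_self) F G hG
  refine ⟨_, hs, ?_, ?_⟩
  · simp [G, hev.deriv_eq]
  · filter_upwards [hev] with t ht
    rw [ht, hev.self_of_nhds]
    have hd : ∀ s : ℝ, HasDerivAt (fun s => g' (t*s)) (t • deriv g' (t*s)) s := by
      intro s
      have h1 : HasDerivAt g' (deriv g' (t*s)) (t*s) := (hg'.1.differentiable (by simp) _).hasDerivAt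
      have h2 : HasDerivAt (fun s => t*s) t s := by simpa using (hasDerivAt_id s).const_mul t
      exact h1.scomp s h2
    have hc : Continuous (fun s => t • deriv g' (t*s)) :=
      ((temperate_deriv hg').1.continuous.comp (by fun_prop)).const_smul t
    have := intervalIntegral.integral_eq_sub_of_hasDerivAt (a := 0) (b := 1) (fun s _ => hd s)
      (hc.intervalIntegrable _ _)
    rw [intervalIntegral.integral_of_le zero_le_one, integral_smul] at this
    simp only [G, one_smul, this]
    simp

end

section
open Filter Topology Set
open scoped ContDiff
open MeasureTheory

open scoped FourierTransform SchwartzMap in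
theorem fourier_rep (f : ℝ → ℂ) (hf : ContDiff ℝ ∞ f) (hs : HasCompactSupport f)
    (hz : ∀ x, 1/4 ≤ |x| → f x = 0) : ∃ c : ℤ → ℂ,
    (∀ M : ℕ, Summable (fun n : ℤ => ‖c n‖ * ((n.natAbs : ℝ) + 2)^M)) ∧
    ∀ x, |x| ≤ 1/4 → f x = ∑' n : ℤ, c n * Complex.exp (2 * Real.pi * Complex.I * n * x) := by
  let g : 𝓢(ℝ, ℂ) := hs.toSchwartzMap hf
  have hg : ∀ x, g x = f x := fun x => rfl
  refine ⟨fun n => (𝓕 g) (n:ℝ), fun M => ?_, fun x hx => ?_⟩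
  · obtain ⟨C, hC, h⟩ := (𝓕 g).decay (M+2) 0
    simp only [norm_iteratedFDeriv_zero] at h
    have hsum : Summable (fun n : ℤ => 3^M * C * (1 / (n:ℝ)^2)) :=
      (Real.summable_one_div_int_pow.2 one_lt_two).mul_left _
    refine Summable.of_norm_bounded_eventually hsum ?_
    have : ∀ᶠ n : ℤ in cofinite, n ≠ 0 := by
      rw [Filter.eventually_cofinite]; simp
    filter_upwards [this] with n hn
    have hn1 : (1:ℝ) ≤ (n.natAbs:ℝ) := by
      exact_mod_cast Nat.one_le_iff_ne_zero.2 (Int.natAbs_ne_zero.2 hn)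
    have hnn : ‖(n:ℝ)‖ = (n.natAbs:ℝ) := by
      rw [Real.norm_eq_abs, Nat.cast_natAbs, Int.cast_abs]
    have hh := h n
    rw [hnn] at hh
    have hsq : (n:ℝ)^2 = (n.natAbs:ℝ)^2 := by rw [← hnn, Real.norm_eq_abs, sq_abs]
    rw [hsq, Real.norm_of_nonneg (by positivity), mul_one_div, le_div_iff₀ (by positivity)]
    have h3 : ((n.natAbs:ℝ)+2)^M ≤ 3^M * (n.natAbs:ℝ)^M := by
      rw [← mul_pow]; gcongr; linarith
    calc ‖(𝓕 g) (n:ℝ)‖ * ((n.natAbs:ℝ)+2)^M * (n.natAbs:ℝ)^2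
        ≤ ‖(𝓕 g) (n:ℝ)‖ * (3^M * (n.natAbs:ℝ)^M) * (n.natAbs:ℝ)^2 := by gcongr
      _ = 3^M * ((n.natAbs:ℝ)^(M+2) * ‖(𝓕 g) (n:ℝ)‖) := by ring
      _ ≤ 3^M * C := by gcongr
  · have := SchwartzMap.tsum_eq_tsum_fourier g x
    rw [tsum_eq_single 0] at this
    · rw [← hg]
      simp only [Int.cast_zero, add_zero] at this
      rw [this]
      congr 1
      ext n
      rw [fourier_coe_apply]
      simp
    · intro n hn
      rw [hg]
      apply hz
      have h1 : (1:ℝ) ≤ |(n:ℝ)| := by exact_mod_cast Int.one_le_abs hn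
      have h2 : |(n:ℝ)| ≤ |x + n| + |x| := by
        have := abs_sub (x+n) x
        simpa using this
      linarith

theorem poisson_re (C : ℂ) (m : ℕ) (ρ : ℝ) (h0 : 0 ≤ ρ) (h1 : ρ < 1) (θ : ℝ) :
    (C * Complex.exp (θ * Complex.I)^m).re * ρ^m = (2*Real.pi)⁻¹ * ∫ φ in (0:ℝ)..(2*Real.pi),
      (C * Complex.exp (φ * Complex.I)^m).re * ((1-ρ^2)/(1+ρ^2-2*ρ*Real.cos (θ-φ))) := by
  let w : ℂ := ρ * Complex.exp (θ * Complex.I)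
  have hwn : ‖w‖ = ρ := by
    simp [w, Complex.norm_exp_ofReal_mul_I, abs_of_nonneg h0]
  have hw : w ∈ Metric.ball (0:ℂ) 1 := by simp [hwn, h1]
  have hdf : DiffContOnCl ℂ (fun z : ℂ => C * z^m) (Metric.ball 0 1) :=
    Differentiable.diffContOnCl (by fun_prop)
  have := hdf.circleAverage_poissonKernel_smul' hw
  rw [Real.circleAverage_def] at this
  have hre := congrArg Complex.reCLM this
  rw [map_smul, ← ContinuousLinearMap.intervalIntegral_comp_comm] at hre
  · simp only [smul_eq_mul, Complex.reCLM_apply] at hre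
    rw [eq_comm] at hre
    convert hre using 1
    · have : C * w^m = ((ρ^m : ℝ):ℂ) * (C * Complex.exp (θ * Complex.I)^m) := by
        simp only [w]; push_cast; ring
      rw [this, Complex.re_ofReal_mul, mul_comm]
    · congr 1
      apply intervalIntegral.integral_congr
      intro φ _
      have hc : circleMap 0 1 φ = Complex.exp (φ * Complex.I) := by simp [circleMap]
      have hn2 : ‖Complex.exp (φ * Complex.I) - w‖^2 = 1+ρ^2-2*ρ*Real.cos (θ-φ) := by
        rw [← Complex.normSq_eq_norm_sq, Complex.normSq_apply]
        simp only [w, Complex.exp_ofReal_mul_I, Complex.sub_re, Complex.sub_im, Complex.re_ofReal_mul,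
          Complex.im_ofReal_mul]
        simp [← Complex.ofReal_cos, ← Complex.ofReal_sin, Real.cos_sub]
        have e1 := Real.sin_sq_add_cos_sq φ
        have e2 := Real.sin_sq_add_cos_sq θ
        linear_combination e1 + ρ^2 * e2
      simp only [hc, sub_zero, hn2, hwn, Complex.norm_exp_ofReal_mul_I, one_pow]
      rw [Complex.real_smul, Complex.re_ofReal_mul, mul_comm]
  · apply ContinuousOn.intervalIntegrable
    apply Continuous.continuousOn
    have hne : ∀ φ, ‖circleMap 0 1 φ - 0 - (w - 0)‖ ^ 2 ≠ 0 := by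
      intro φ h
      have h2 : circleMap 0 1 φ = w := by
        have := norm_eq_zero.1 (pow_eq_zero_iff (two_ne_zero) |>.1 h)
        simpa [sub_eq_zero] using this
      have h3 : ‖circleMap 0 1 φ‖ = 1 := by simp
      rw [h2, hwn] at h3
      exact absurd h3 h1.ne
    have hcm : Continuous (circleMap 0 1) := continuous_circleMap 0 1
    exact ((((hcm.sub continuous_const).norm.pow 2).sub continuous_const).div
      (((hcm.sub continuous_const).sub continuous_const).norm.pow 2) hne).smul
      (continuous_const.mul (hcm.pow m))

end

section
open Filter Topology Set
open scoped ContDiff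
open MeasureTheory

noncomputable def rho (m : ℕ) : ℝ := 1 - 1/((m:ℝ)+2)

theorem rho_ge (m : ℕ) : 1/2 ≤ rho m := by
  unfold rho
  have : 1/((m:ℝ)+2) ≤ 1/2 := by gcongr; linarith [(Nat.cast_nonneg m : (0:ℝ) ≤ m)]
  linarith

theorem rho_lt (m : ℕ) : rho m < 1 := by
  unfold rho
  have : 0 < 1/((m:ℝ)+2) := by positivity
  linarith

theorem rho_pow (m : ℕ) : 1 / rho m ^ m ≤ Real.exp 1 := by
  have hr : 0 < rho m := by linarith [rho_ge m]
  have hm : (0:ℝ) ≤ m := Nat.cast_nonneg m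
  have h1 : 1 / rho m = 1 + 1/((m:ℝ)+1) := by
    unfold rho at *
    field_simp
    rw [div_eq_iff (by linarith)]
    ring
  rw [← one_div_pow, h1]
  calc (1 + 1/((m:ℝ)+1))^m ≤ (Real.exp (1/((m:ℝ)+1)))^m := by
        gcongr
        rw [add_comm]; exact Real.add_one_le_exp _
    _ = Real.exp (m * (1/((m:ℝ)+1))) := (Real.exp_nat_mul _ _).symm
    _ ≤ _ := by
        apply Real.exp_le_exp.2
        rw [mul_one_div, div_le_one (by positivity)]
        linarith

noncomputable def repP (o : ℤ × ℝ) : R4 :=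
  ![1 + rho o.1.natAbs ^ 2 + 2 * rho o.1.natAbs * Real.cos o.2,
    -4 * rho o.1.natAbs * Real.sin o.2,
    1 + rho o.1.natAbs ^ 2 - 2 * rho o.1.natAbs * Real.cos o.2,
    (o.1.natAbs : ℝ) + 2]

theorem repP_props (o : ℤ × ℝ) : 1 ≤ repP o 3 ∧ 0 < repP o 0 ∧ repP o 0 ≤ 4 ∧
    4 ≤ (repP o 3)^2 * (4 * repP o 0 * repP o 2 - (repP o 1)^2) := by
  have h1 := rho_ge o.1.natAbs
  have h2 := rho_lt o.1.natAbs
  have hm : (0:ℝ) ≤ o.1.natAbs := Nat.cast_nonneg _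
  have hN : ((o.1.natAbs:ℝ)+2) * (1 - rho o.1.natAbs) = 1 := by unfold rho; field_simp; ring
  have c1 := Real.cos_le_one o.2
  have c2 := Real.neg_one_le_cos o.2
  have cs := Real.sin_sq_add_cos_sq o.2
  simp only [repP, Matrix.cons_val]
  set r := rho o.1.natAbs
  set N := (o.1.natAbs:ℝ)+2
  refine ⟨by simp only [N]; linarith, by nlinarith, by nlinarith, ?_⟩
  have : N^2 * (4 * (1 + r^2 + 2*r*Real.cos o.2) * (1 + r^2 - 2*r*Real.cos o.2) - (-4*r*Real.sin o.2)^2)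
      = 4 * (N*(1-r))^2 * (1+r)^2 := by
    linear_combination (-16 * N^2*r^2) * cs
  rw [this, hN]
  nlinarith

theorem repP_norm (o : ℤ × ℝ) : 1 + ‖repP o‖ ≤ 5 * ((o.1.natAbs : ℝ) + 2) := by
  have h1 := rho_ge o.1.natAbs
  have h2 := rho_lt o.1.natAbs
  have hm : (0:ℝ) ≤ o.1.natAbs := Nat.cast_nonneg _
  have c1 := Real.cos_le_one o.2
  have c2 := Real.neg_one_le_cos o.2
  have c3 := Real.sin_le_one o.2
  have c4 := Real.neg_one_le_sin o.2
  have : ‖repP o‖ ≤ 4 + o.1.natAbs := by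
    rw [pi_norm_le_iff_of_nonneg (by positivity)]
    intro i
    rw [Real.norm_eq_abs, abs_le]
    fin_cases i <;> simp only [repP, Matrix.cons_val, Fin.reduceFinMk, Fin.zero_eta, Fin.mk_one] <;> constructor <;> nlinarith
  linarith

noncomputable def ccoef (c : ℤ → ℂ) (n : ℤ) : ℂ := if 0 ≤ n then c n else (starRingEnd ℂ) (c n)

theorem ccoef_re (c : ℤ → ℂ) (n : ℤ) (x : ℝ) :
    (c n * Complex.exp (2 * Real.pi * Complex.I * n * x)).re =
    (ccoef c n * Complex.exp (((2*Real.pi*x : ℝ):ℂ) * Complex.I)^n.natAbs).re := by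
  unfold ccoef
  rw [← Complex.exp_nat_mul]
  split_ifs with h
  · congr 3
    obtain ⟨m, rfl⟩ := Int.eq_ofNat_of_zero_le h
    push_cast
    simp
    ring
  · have hn : (n:ℂ) = -(n.natAbs:ℂ) := by
      have : n = -(n.natAbs:ℤ) := by omega
      exact_mod_cast congrArg (Int.cast : ℤ → ℂ) this
    rw [← Complex.conj_re, map_mul, ← Complex.exp_conj]
    congr 3
    rw [hn]
    simp only [map_mul, Complex.conj_ofReal, Complex.conj_I, map_neg, Complex.conj_natCast, map_ofNat]
    push_cast
    ring

noncomputable def repW (c : ℤ → ℂ) (o : ℤ × ℝ) : ℝ :=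
  (ccoef c o.1 * Complex.exp (o.2 * Complex.I)^o.1.natAbs).re *
    ((1 - rho o.1.natAbs^2) * (1 / rho o.1.natAbs ^ o.1.natAbs) * (2*Real.pi)⁻¹)

theorem repW_abs (c : ℤ → ℂ) (o : ℤ × ℝ) : |repW c o| ≤ ‖c o.1‖ * (Real.exp 1) := by
  unfold repW
  rw [abs_mul]
  have h1 := rho_ge o.1.natAbs
  have h2 := rho_lt o.1.natAbs
  have hc : ‖ccoef c o.1‖ = ‖c o.1‖ := by unfold ccoef; split_ifs <;> simp
  have h3 : |(ccoef c o.1 * Complex.exp (o.2 * Complex.I)^o.1.natAbs).re| ≤ ‖c o.1‖ := by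
    refine (Complex.abs_re_le_norm _).trans ?_
    rw [norm_mul, norm_pow, Complex.norm_exp_ofReal_mul_I, one_pow, mul_one, hc]
  have h4 := rho_pow o.1.natAbs
  have h5 : (2*Real.pi)⁻¹ ≤ 1 := inv_le_one_of_one_le₀ (by linarith [Real.pi_gt_three])
  have h6 : 0 ≤ 1 - rho o.1.natAbs^2 := by nlinarith
  have h7 : 1 - rho o.1.natAbs^2 ≤ 1 := by nlinarith
  have h8 : 0 ≤ 1 / rho o.1.natAbs ^ o.1.natAbs := by positivity
  have h9 : 0 ≤ (2*Real.pi)⁻¹ := by positivity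
  gcongr
  rw [abs_of_nonneg (by positivity)]
  calc _ ≤ 1 * Real.exp 1 * 1 := by gcongr
    _ = _ := by ring

noncomputable def repMu : Measure (ℤ × ℝ) :=
  (Measure.count : Measure ℤ).prod (volume.restrict (Ioc 0 (2*Real.pi)))

theorem repW_cont (c : ℤ → ℂ) : Continuous (repW c) := by
  rw [continuous_prod_of_discrete_left]
  intro n
  unfold repW
  simp only
  refine (Complex.continuous_re.comp ?_).mul continuous_const
  fun_prop

theorem repP_cont : Continuous repP := by
  rw [continuous_prod_of_discrete_left]
  intro n
  unfold repP
  refine continuous_pi fun i => ?_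
  fin_cases i <;> simp <;> fun_prop

theorem rep_integrable (c : ℤ → ℂ)
    (hc : ∀ M : ℕ, Summable (fun n : ℤ => ‖c n‖ * ((n.natAbs : ℝ) + 2)^M)) (M : ℕ) :
    Integrable (fun o => |repW c o| * (1 + ‖repP o‖)^M) repMu := by
  have h1 : Integrable (fun n : ℤ => Real.exp 1 * 5^M * (‖c n‖ * ((n.natAbs : ℝ) + 2)^M)) Measure.count := by
    rw [integrable_count_iff]
    exact ((hc M).mul_left _).norm
  have h2 : Integrable (fun _ : ℝ => (1:ℝ)) (volume.restrict (Ioc 0 (2*Real.pi))) := by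
    simp
  have h3 := h1.mul_prod h2
  refine h3.mono' ?_ (ae_of_all _ fun o => ?_)
  · exact ((repW_cont c).abs.mul ((continuous_const.add repP_cont.norm).pow M)).aestronglyMeasurable
  · rw [Real.norm_of_nonneg (by positivity)]
    have a1 := repW_abs c o
    have a2 := repP_norm o
    calc |repW c o| * (1 + ‖repP o‖)^M ≤ (‖c o.1‖ * Real.exp 1) * (5 * ((o.1.natAbs : ℝ) + 2))^M := by
          gcongr
      _ = _ := by rw [mul_pow]; ring

theorem tan_quad (x φ r : ℝ) (hx : Real.cos (Real.pi*x) ≠ 0) :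
    let t := Real.tan (Real.pi*x)
    1 + r^2 - 2*r*Real.cos (2*Real.pi*x-φ) = ((1+r^2+2*r*Real.cos φ)*t^2 + (-4*r*Real.sin φ)*t +
      (1+r^2-2*r*Real.cos φ)) * Real.cos (Real.pi*x)^2 := by
  intro t
  have ht : t * Real.cos (Real.pi*x) = Real.sin (Real.pi*x) := Real.tan_mul_cos hx
  have e : 2*Real.pi*x = 2*(Real.pi*x) := by ring
  rw [Real.cos_sub, e, Real.cos_two_mul, Real.sin_two_mul]
  have cs := Real.sin_sq_add_cos_sq (Real.pi*x)
  set C := Real.cos (Real.pi*x)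
  rw [← ht] at cs ⊢
  linear_combination (-(1+r^2)-2*r*Real.cos φ) * cs

theorem rep_sum (c : ℤ → ℂ)
    (hc : ∀ M : ℕ, Summable (fun n : ℤ => ‖c n‖ * ((n.natAbs : ℝ) + 2)^M)) (x : ℝ)
    (hx : Real.cos (Real.pi*x) ≠ 0)
    (hI : Integrable (fun o => repW c o * (repP o 0 * Real.tan (Real.pi*x)^2 +
      repP o 1 * Real.tan (Real.pi*x) + repP o 2)⁻¹) repMu) :
    (∑' n : ℤ, c n * Complex.exp (2 * Real.pi * Complex.I * n * x)).re * Real.cos (Real.pi*x)^2 =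
    ∫ o, repW c o * (repP o 0 * Real.tan (Real.pi*x)^2 +
      repP o 1 * Real.tan (Real.pi*x) + repP o 2)⁻¹ ∂repMu := by
  have hsum : Summable (fun n : ℤ => c n * Complex.exp (2 * Real.pi * Complex.I * n * x)) := by
    apply Summable.of_norm
    have := hc 0
    simp only [pow_zero, mul_one] at this
    refine this.congr fun n => ?_
    rw [norm_mul]
    have : (2 * Real.pi * Complex.I * n * x : ℂ) = ((2*Real.pi*n*x : ℝ):ℂ) * Complex.I := by
      push_cast; ring
    rw [this, Complex.norm_exp_ofReal_mul_I, mul_one]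
  have h1 : (∑' n : ℤ, c n * Complex.exp (2 * Real.pi * Complex.I * n * x)).re =
      ∑' n : ℤ, (c n * Complex.exp (2 * Real.pi * Complex.I * n * x)).re :=
    Complex.reCLM.map_tsum hsum
  rw [h1, ← tsum_mul_right]
  unfold repMu at *
  rw [integral_prod _ hI, integral_countable hI.integral_prod_left]
  congr 1
  ext n
  simp only [measureReal_def, Measure.count_singleton, ENNReal.toReal_one, one_smul]
  rw [ccoef_re]
  have hr1 := rho_ge n.natAbs
  have hr2 := rho_lt n.natAbs
  have hp := poisson_re (ccoef c n) n.natAbs (rho n.natAbs) (by linarith) hr2 (2*Real.pi*x)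
  have hpow : rho n.natAbs ^ n.natAbs ≠ 0 := by positivity
  have hp2 := (eq_div_iff hpow).2 hp
  rw [hp2, intervalIntegral.integral_of_le (by positivity)]
  rw [div_mul_eq_mul_div, mul_comm (_⁻¹) (∫ _, _ ∂_), mul_assoc, mul_div_assoc,
    ← integral_mul_const]
  congr 1
  ext φ
  rw [tan_quad x φ _ hx]
  simp only [repW, repP, Matrix.cons_val]
  field_simp

theorem rep (k : ℝ → ℝ) (hk : ContDiff ℝ ∞ k) : ∃ c : ℤ → ℂ,
    (∀ M : ℕ, Summable (fun n : ℤ => ‖c n‖ * ((n.natAbs : ℝ) + 2)^M)) ∧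
    ∀ᶠ t in 𝓝 (0:ℝ), (Integrable (fun o => repW c o * (repP o 0 * t^2 + repP o 1 * t + repP o 2)⁻¹) repMu) →
      k t = ∫ o, repW c o * (repP o 0 * t^2 + repP o 1 * t + repP o 2)⁻¹ ∂repMu := by
  let ψ : ContDiffBump (0:ℝ) := ⟨1/8, 1/4, by norm_num, by norm_num⟩
  let f0 : ℝ → ℝ := fun x => ψ x * (k (Real.tan (Real.pi*x)) * ((Real.cos (Real.pi*x))^2)⁻¹)
  let f : ℝ → ℂ := fun x => ((f0 x : ℝ) : ℂ)
  have hout : ∀ x : ℝ, 1/4 ≤ |x| → ψ x = 0 := fun x hx =>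
    ψ.zero_of_le_dist (by simp only [dist_zero_right, Real.norm_eq_abs]; exact hx)
  have hcos : ∀ x : ℝ, |x| < 1/2 → Real.cos (Real.pi*x) ≠ 0 := by
    intro x hx
    have := abs_lt.1 hx
    apply (Real.cos_pos_of_mem_Ioo ⟨?_, ?_⟩).ne' <;> nlinarith [Real.pi_pos]
  have hf0 : ContDiff ℝ ∞ f0 := by
    rw [contDiff_iff_contDiffAt]
    intro x
    rcases lt_or_ge |x| (1/2) with h | h
    · have hc := hcos x h
      have h1 : ContDiffAt ℝ ∞ (fun x => Real.pi * x) x := by fun_prop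
      have h2 : ContDiffAt ℝ ∞ (fun x => Real.tan (Real.pi * x)) x :=
        (Real.contDiffAt_tan.2 hc).comp x h1
      have h3 : ContDiffAt ℝ ∞ (fun x => Real.cos (Real.pi * x)) x :=
        Real.contDiff_cos.contDiffAt.comp x h1
      exact ψ.contDiffAt.mul ((hk.contDiffAt.comp x h2).mul ((h3.pow 2).inv (pow_ne_zero 2 hc)))
    · have : f0 =ᶠ[𝓝 x] fun _ => (0:ℝ) := by
        have : {y : ℝ | 1/4 < |y|} ∈ 𝓝 x :=
          (isOpen_lt continuous_const continuous_abs).mem_nhds (by show 1/4 < |x|; linarith)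
        filter_upwards [this] with y hy
        simp only [f0, hout y (le_of_lt hy), zero_mul]
      exact contDiffAt_const.congr_of_eventuallyEq this
  have hf : ContDiff ℝ ∞ f := Complex.ofRealCLM.contDiff.comp hf0
  have hcs : HasCompactSupport f0 := ψ.hasCompactSupport.mul_right
  obtain ⟨c, hc, hfc⟩ := fourier_rep f hf (hcs.comp_left (g := fun x : ℝ => (x:ℂ)) (by simp)) (by
    intro x hx
    simp only [f, f0, hout x hx, zero_mul, Complex.ofReal_zero])
  refine ⟨c, hc, ?_⟩
  have hcont : Tendsto (fun t => Real.arctan t / Real.pi) (𝓝 0) (𝓝 0) := by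
    have : Continuous (fun t => Real.arctan t / Real.pi) := Real.continuous_arctan.div_const _
    simpa using this.tendsto 0
  filter_upwards [hcont.eventually (Metric.ball_mem_nhds (0:ℝ) (show (0:ℝ) < 1/8 by norm_num))] with t ht hI
  set x := Real.arctan t / Real.pi with hx
  have hx8 : |x| < 1/8 := by simpa using ht
  have hpx : Real.pi * x = Real.arctan t := by rw [hx]; field_simp
  have htan : Real.tan (Real.pi*x) = t := by rw [hpx, Real.tan_arctan]
  have hcx := hcos x (by linarith)
  have hs := rep_sum c hc x hcx (by rw [htan]; exact hI)
  rw [← hfc x (by linarith), htan] at hs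
  rw [← hs]
  have hψ : ψ x = 1 := ψ.one_of_mem_closedBall
      (by simp only [Metric.mem_closedBall, dist_zero_right, Real.norm_eq_abs]; exact hx8.le)
  simp only [f, f0, hψ, htan, Complex.ofReal_re, one_mul]
  field_simp

end

section
open Filter Topology Set
open scoped ContDiff
open MeasureTheory

theorem quad_pos_rep (o : ℤ × ℝ) (t : ℝ) :
    1 ≤ 4 * (repP o 3)^2 * (repP o 0 * t^2 + repP o 1 * t + repP o 2) := by
  obtain ⟨h1, h2, h3, h4⟩ := repP_props o
  have hn0 : 0 < repP o 3 := by linarith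
  obtain ⟨ε, hε, hεn⟩ : ∃ ε : ℝ, 0 < ε ∧ repP o 3 * ε = 1 := ⟨(repP o 3)⁻¹, by positivity, by field_simp⟩
  have hd' : 4 * ε^2 ≤ 4*repP o 0*repP o 2 - (repP o 1)^2 := by
    have h1 := mul_le_mul_of_nonneg_left h4 (sq_nonneg ε)
    have h2 : ε^2 * ((repP o 3)^2*(4*repP o 0*repP o 2 - (repP o 1)^2)) =
      (repP o 3*ε)^2*(4*repP o 0*repP o 2 - (repP o 1)^2) := by ring
    rw [h2, hεn] at h1
    linarith
  have hD := quad_lower h2 h3 hε hd' t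
  calc (1:ℝ) = (repP o 3*ε)^2 := by rw [hεn]; norm_num
        _ = 4*(repP o 3)^2 * (ε^2/4) := by ring
        _ ≤ _ := by gcongr

theorem rep_full (k : ℝ → ℝ) (hk : ContDiff ℝ ∞ k) : ∃ c : ℤ → ℂ,
    (∀ M : ℕ, Integrable (fun o => |repW c o| * (1 + ‖repP o‖)^M) repMu) ∧
    ∃ η : ℝ, 0 < η ∧ ∀ t, |t| < η →
      k t = ∫ o, repW c o * (repP o 0 * t^2 + repP o 1 * t + repP o 2)⁻¹ ∂repMu ∧
      deriv k t = ∫ o, repW c o * (-(2 * repP o 0 * t + repP o 1) *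
        ((repP o 0 * t^2 + repP o 1 * t + repP o 2)⁻¹)^2) ∂repMu := by
  obtain ⟨c, hc, hev⟩ := rep k hk
  have hi := rep_integrable c hc
  have hw := (repW_cont c).aestronglyMeasurable (μ := repMu)
  have hp := repP_cont.aestronglyMeasurable (μ := repMu)
  obtain ⟨κ, hκ, hκ1⟩ := exists_kappa
  let G : ℝ × R4 → ℝ := fun z => kapN κ (4*(z.2 3)^2) (z.2 0 * z.1^2 + z.2 1 * z.1 + z.2 2)
  have hG : G.HasTemperateGrowth := by
    have h1 : Function.HasTemperateGrowth (fun p : ℝ × R4 => p.1) :=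
      (ContinuousLinearMap.fst ℝ ℝ R4).hasTemperateGrowth
    have h2 : ∀ j : Fin 4, Function.HasTemperateGrowth (fun p : ℝ × R4 => p.2 j) := fun j =>
      ((ContinuousLinearMap.proj (R := ℝ) (φ := fun _ : Fin 4 => ℝ) j).comp
        (ContinuousLinearMap.snd ℝ ℝ R4)).hasTemperateGrowth
    have a0 := h2 0
    have a1 := h2 1
    have a2 := h2 2
    have a3 := h2 3
    have := hκ.comp (f := fun z : ℝ × R4 => 4*(z.2 3)^2 * (z.2 0 * z.1^2 + z.2 1 * z.1 + z.2 2)) (by fun_prop)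
    simp only [G, kapN]
    apply Function.HasTemperateGrowth.mul
    · fun_prop
    · exact this
  have hGeq : ∀ o t, G (t, repP o) = (repP o 0 * t^2 + repP o 1 * t + repP o 2)⁻¹ := by
    intro o t
    have hpos : 0 < repP o 3 := by linarith [(repP_props o).1]
    exact kapN_eq hκ1 (by positivity) (quad_pos_rep o t)
  have hIntg : ∀ t, Integrable (fun o => repW c o * (repP o 0 * t^2 + repP o 1 * t + repP o 2)⁻¹) repMu := by
    intro t
    have := param_integrable ℝ hG hw hp hi t
    simpa only [hGeq, smul_eq_mul] using this
  have hev2 : ∀ᶠ t in 𝓝 (0:ℝ), k t = ∫ o, repW c o * (repP o 0 * t^2 + repP o 1 * t + repP o 2)⁻¹ ∂repMu :=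
    hev.mono fun t ht => ht (hIntg t)
  obtain ⟨η, hη, hball⟩ := Metric.eventually_nhds_iff.1 hev2.eventually_nhds
  refine ⟨c, hi, η, hη, fun t ht => ?_⟩
  have h1 := hball (y := t) (by simpa using ht)
  refine ⟨h1.self_of_nhds, ?_⟩
  have h2 : k =ᶠ[𝓝 t] fun t => ∫ o, repW c o • G (t, repP o) ∂repMu := by
    filter_upwards [h1] with s hs
    rw [hs]
    simp only [hGeq, smul_eq_mul]
  have hfd := param_hasFDerivAt ℝ hG hw hp hi t
  have hG' : Function.HasTemperateGrowth
      (fun z => (fderiv ℝ G z).comp (ContinuousLinearMap.inl ℝ ℝ R4)) :=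
    (((ContinuousLinearMap.compL ℝ ℝ (ℝ × R4) ℝ).flip
      (ContinuousLinearMap.inl ℝ ℝ R4)).hasTemperateGrowth).comp (temperate_fderiv hG)
  have hI := param_integrable _ hG' hw hp hi t
  rw [h2.deriv_eq, hfd.hasDerivAt.deriv, ContinuousLinearMap.integral_apply hI]
  congr 1
  ext o
  have hd1 : HasFDerivAt G (fderiv ℝ G (t, repP o)) (t, repP o) :=
      (hG.1.differentiable (by simp) _).hasFDerivAt
  have hd2 := (hd1.comp t (hasFDerivAt_prodMk_left t (repP o))).hasDerivAt
  have hpos : 0 < repP o 0 * t^2 + repP o 1 * t + repP o 2 := by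
    by_contra h
    have := quad_pos_rep o t
    have h3 : 4 * (repP o 3)^2 * (repP o 0 * t^2 + repP o 1 * t + repP o 2) ≤ 0 :=
      mul_nonpos_of_nonneg_of_nonpos (by positivity) (not_lt.1 h)
    linarith
  have hd3 : HasDerivAt (G ∘ fun e => (e, repP o)) (-(2 * repP o 0 * t + repP o 1) *
        ((repP o 0 * t^2 + repP o 1 * t + repP o 2)⁻¹)^2) t := by
    have : (G ∘ fun e => (e, repP o)) = fun t => (repP o 0 * t^2 + repP o 1 * t + repP o 2)⁻¹ :=
      funext fun s => hGeq o s
    rw [this]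
    have hq : HasDerivAt (fun t => repP o 0 * t^2 + repP o 1 * t + repP o 2) (2 * repP o 0 * t + repP o 1) t := by
      have := (((hasDerivAt_pow 2 t).const_mul (repP o 0)).add ((hasDerivAt_id t).const_mul (repP o 1))).add_const (repP o 2)
      convert! this using 1
      simp; ring
    convert! hq.inv hpos.ne' using 1
    field_simp
  have := hd2.unique hd3
  simp only [smul_eq_mul, smul_apply]
  rw [← this]

/-- swallowtail points: quartics with the double root `x` -/
def swPt (x H e : ℝ) : R4 := ![H-2*x^2, -2*x*H, x^2*(x^2+H), e]

def Interp (r : R4) (x v d : ℝ) : Prop :=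
  r 0 + r 1 * x + r 2 * x^2 + r 3 * x^3 = v ∧ r 1 + 2 * r 2 * x + 3 * r 3 * x^2 = d

/-- smooth first order Hermite interpolation along the double-root locus -/
theorem crux (k : ℝ → ℝ) (hk : ContDiff ℝ ∞ k) : ∃ R : R4 → R4, ContDiff ℝ ∞ R ∧
    ∃ η : ℝ, 0 < η ∧ ∀ x H e, |x - e| < η → Interp (R (swPt x H e)) x (k (x-e)) (deriv k (x-e)) := by
  obtain ⟨c, hi, η, hη, hrep⟩ := rep_full k hk
  obtain ⟨G, hG, hGe⟩ := kernel_exists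
  have hw := (repW_cont c).aestronglyMeasurable (μ := repMu)
  have hp := repP_cont.aestronglyMeasurable (μ := repMu)
  refine ⟨fun l i => ∫ o, repW c o • G i (l, repP o) ∂repMu, ?_, η, hη, ?_⟩
  · rw [contDiff_pi]
    exact fun i => param_smooth hw hp hi ℝ (G i) (hG i)
  · intro x H e hx
    obtain ⟨h1, h2⟩ := hrep (x-e) hx
    have hI := fun i => param_integrable ℝ (hG i) hw hp hi (swPt x H e)
    have hpt : ∀ o, (![repP o 0, repP o 1, repP o 2, repP o 3] : R4) = repP o := by
      intro o; ext i; fin_cases i <;> rfl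
    have key := fun o => hGe x H e (repP o 0) (repP o 1) (repP o 2) (repP o 3) (repP_props o).1
      (repP_props o).2.1 (repP_props o).2.2.1 (repP_props o).2.2.2
    simp only [hpt] at key
    simp only [smul_eq_mul] at hI
    constructor
    · simp only [smul_eq_mul]
      rw [h1, ← integral_mul_const, ← integral_mul_const, ← integral_mul_const,
        ← integral_add (hI 0) ((hI 1).mul_const _), ← integral_add _ ((hI 2).mul_const _),
        ← integral_add _ ((hI 3).mul_const _)]
      · congr 1
        ext o
        rw [← (key o).1]
        simp only [swPt]
        ring
      · exact ((hI 0).add ((hI 1).mul_const _)).add ((hI 2).mul_const _)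
      · exact (hI 0).add ((hI 1).mul_const _)
    · simp only [smul_eq_mul]
      rw [h2, ← integral_const_mul, ← integral_const_mul, ← integral_mul_const, ← integral_mul_const,
        ← integral_add (hI 1) (((hI 2).const_mul _).mul_const _),
        ← integral_add _ (((hI 3).const_mul _).mul_const _)]
      · congr 1
        ext o
        rw [← (key o).2]
        simp only [swPt]
        ring
      · exact (hI 1).add (((hI 2).const_mul _).mul_const _)

end

section
open Filter Topology Set
open scoped ContDiff

theorem ift_wrap {E F : Type} [NormedAddCommGroup E] [NormedSpace ℝ E] [FiniteDimensional ℝ E]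
    [NormedAddCommGroup F] [NormedSpace ℝ F] [FiniteDimensional ℝ F]
    (hEF : Module.finrank ℝ E = Module.finrank ℝ F) (f : E → F) (a : E) (hf : ContDiffAt ℝ ∞ f a)
    (hinj : ∀ v, fderiv ℝ f a v = 0 → v = 0) :
    ∃ g : F → E, ContDiffAt ℝ ∞ g (f a) ∧ g (f a) = a ∧ (∀ᶠ x in 𝓝 a, g (f x) = x) ∧
      ∀ᶠ y in 𝓝 (f a), f (g y) = y := by
  have : CompleteSpace E := FiniteDimensional.complete ℝ E
  let L : E →ₗ[ℝ] F := (fderiv ℝ f a : E →ₗ[ℝ] F)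
  have hL : Function.Injective L := by
    rw [← LinearMap.ker_eq_bot, LinearMap.ker_eq_bot']
    exact fun v hv => hinj v hv
  let e : E ≃L[ℝ] F := (LinearEquiv.ofInjectiveOfFinrankEq L hL hEF).toContinuousLinearEquiv
  have he : (e : E →L[ℝ] F) = fderiv ℝ f a := by
    ext v; rfl
  have hd : HasFDerivAt f (e : E →L[ℝ] F) a := by
    rw [he]; exact (hf.differentiableAt (by simp)).hasFDerivAt
  have hn : (∞ : WithTop ℕ∞) ≠ 0 := by simp
  have hstrict := hf.hasStrictFDerivAt' hd hn
  refine ⟨hf.localInverse hd hn, hf.to_localInverse hd hn, ?_, ?_, ?_⟩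
  · exact hf.localInverse_apply_image hd hn
  · exact hstrict.eventually_left_inverse
  · exact hstrict.eventually_right_inverse

theorem hasFDerivAt_smul_zero {E F : Type} [NormedAddCommGroup E] [NormedSpace ℝ E]
    [NormedAddCommGroup F] [NormedSpace ℝ F] {f : E → ℝ} {f' : E →L[ℝ] ℝ} {V : E → F} {a : E}
    (hf : HasFDerivAt f f' a) (h0 : f a = 0) (hV : DifferentiableAt ℝ V a) :
    HasFDerivAt (fun z => f z • V z) (f'.smulRight (V a)) a := by
  exact (hf.smul hV.hasFDerivAt).congr_fderiv (by simp [h0])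

abbrev R3 := Fin 3 → ℝ

/-- multiplication by `T - e` modulo `T^4 + aT^2 + bT + c` -/
def mulE (l : R4) (e : ℝ) (r : R4) : R4 :=
  ![-e * r 0 - l 2 * r 3, r 0 - e * r 1 - l 1 * r 3, r 1 - e * r 2 - l 0 * r 3, r 2 - e * r 3]

theorem Interp.mulE {r : R4} {x v d : ℝ} (h : Interp r x v d) (H e e' : ℝ) :
    Interp (mulE (swPt x H e') e r) x ((x-e)*v) (v+(x-e)*d) := by
  obtain ⟨h1, h2⟩ := h
  constructor
  · simp [_root_.mulE, swPt]
    linear_combination (x-e) * h1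
  · simp [_root_.mulE, swPt]
    linear_combination h1 + (x-e) * h2

theorem Interp.add {r s : R4} {x v d v' d' : ℝ} (h : Interp r x v d) (h' : Interp s x v' d') :
    Interp (r + s) x (v+v') (d+d') := by
  obtain ⟨h1, h2⟩ := h
  obtain ⟨h3, h4⟩ := h'
  constructor
  · simp; linear_combination h1 + h3
  · simp; linear_combination h2 + h4

theorem Interp.smul {r : R4} {x v d : ℝ} (h : Interp r x v d) (c : ℝ) :
    Interp (c • r) x (c*v) (c*d) := by
  obtain ⟨h1, h2⟩ := h
  constructor
  · simp; linear_combination c * h1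
  · simp; linear_combination c * h2

def Psi (Rn R1 Rl Rk : R4 → R4) (z : R3 × R4) : R4 :=
  z.1 0 • Rn z.2 + z.1 1 • mulE z.2 (z.2 3) (R1 z.2)
   + z.1 2 • mulE z.2 (z.2 3) (mulE z.2 (z.2 3) (Rl z.2))
   + (z.2 2 - z.2 3^4) • Rk z.2 + (z.2 1 + 4 * z.2 3^3) • mulE z.2 0 (Rk z.2)
   + (z.2 0 - 6 * z.2 3^2) • mulE z.2 0 (mulE z.2 0 (Rk z.2))
   + (4 * z.2 3) • mulE z.2 0 (mulE z.2 0 (mulE z.2 0 (Rk z.2)))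

theorem mulE_contDiff {E : Type} [NormedAddCommGroup E] [NormedSpace ℝ E] {l : E → R4} {e : E → ℝ}
    {r : E → R4} (hl : ContDiff ℝ ∞ l) (he : ContDiff ℝ ∞ e) (hr : ContDiff ℝ ∞ r) :
    ContDiff ℝ ∞ (fun z => mulE (l z) (e z) (r z)) := by
  have hl' := fun i => contDiff_pi.1 hl i
  have hr' := fun i => contDiff_pi.1 hr i
  have a0 := hl' 0
  have a1 := hl' 1
  have a2 := hl' 2
  have b0 := hr' 0
  have b1 := hr' 1
  have b2 := hr' 2
  have b3 := hr' 3
  rw [contDiff_pi]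
  intro i
  fin_cases i <;> simp [mulE] <;> fun_prop

section

theorem Psi_contDiff {Rn R1 Rl Rk : R4 → R4} (hRn : ContDiff ℝ ∞ Rn) (hR1 : ContDiff ℝ ∞ R1)
    (hRl : ContDiff ℝ ∞ Rl) (hRk : ContDiff ℝ ∞ Rk) : ContDiff ℝ ∞ (Psi Rn R1 Rl Rk) := by
  have h2 : ContDiff ℝ ∞ (fun z : R3 × R4 => z.2) := contDiff_snd
  have h23 : ContDiff ℝ ∞ (fun z : R3 × R4 => z.2 3) := contDiff_pi.1 h2 3
  have h1 : ContDiff ℝ ∞ (fun z : R3 × R4 => z.1) := contDiff_fst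
  have h1i := fun i => contDiff_pi.1 h1 i
  have h2i := fun i => contDiff_pi.1 h2 i
  have k0 := hRk.comp h2
  have k1 := mulE_contDiff h2 (contDiff_const (c := (0:ℝ))) k0
  have k2 := mulE_contDiff h2 (contDiff_const (c := (0:ℝ))) k1
  have k3 := mulE_contDiff h2 (contDiff_const (c := (0:ℝ))) k2
  have r1 := mulE_contDiff h2 h23 (hR1.comp h2)
  have l1 := mulE_contDiff h2 h23 (hRl.comp h2)
  have l2 := mulE_contDiff h2 h23 l1
  have n0 := hRn.comp h2
  exact ((((((h1i 0).smul n0).add ((h1i 1).smul r1)).add ((h1i 2).smul l2)).add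
    (((h2i 2).sub (h23.pow 4)).smul k0)).add (((h2i 1).add (contDiff_const.mul (h23.pow 3))).smul k1)).add
    (((h2i 0).sub (contDiff_const.mul (h23.pow 2))).smul k2) |>.add ((contDiff_const.mul h23).smul k3)

/-- triangular form of the derivative of `Psi` at the origin -/
theorem Psi_fderiv {Rn R1 Rl Rk : R4 → R4} (hRn : ContDiff ℝ ∞ Rn) (hR1 : ContDiff ℝ ∞ R1)
    (hRl : ContDiff ℝ ∞ Rl) (hRk : ContDiff ℝ ∞ Rk) (v : R3 × R4) : fderiv ℝ (Psi Rn R1 Rl Rk) 0 v =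
    v.1 0 • Rn 0 + v.1 1 • mulE 0 0 (R1 0) + v.1 2 • mulE 0 0 (mulE 0 0 (Rl 0))
    + v.2 2 • Rk 0 + v.2 1 • mulE 0 0 (Rk 0) + v.2 0 • mulE 0 0 (mulE 0 0 (Rk 0))
    + (4 * v.2 3) • mulE 0 0 (mulE 0 0 (mulE 0 0 (Rk 0))) := by
  have h2 : ContDiff ℝ ∞ (fun z : R3 × R4 => z.2) := contDiff_snd
  have h23 : ContDiff ℝ ∞ (fun z : R3 × R4 => z.2 3) := contDiff_pi.1 h2 3
  have k0 := hRk.comp h2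
  have k1 := mulE_contDiff h2 (contDiff_const (c := (0:ℝ))) k0
  have k2 := mulE_contDiff h2 (contDiff_const (c := (0:ℝ))) k1
  have k3 := mulE_contDiff h2 (contDiff_const (c := (0:ℝ))) k2
  have r1 := mulE_contDiff h2 h23 (hR1.comp h2)
  have l1 := mulE_contDiff h2 h23 (hRl.comp h2)
  have l2 := mulE_contDiff h2 h23 l1
  have n0 := hRn.comp h2
  let p1 : Fin 3 → (R3 × R4) →L[ℝ] ℝ := fun j =>
    (ContinuousLinearMap.proj (R := ℝ) (φ := fun _ : Fin 3 => ℝ) j).comp (ContinuousLinearMap.fst ℝ R3 R4)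
  let p2 : Fin 4 → (R3 × R4) →L[ℝ] ℝ := fun j =>
    (ContinuousLinearMap.proj (R := ℝ) (φ := fun _ : Fin 4 => ℝ) j).comp (ContinuousLinearMap.snd ℝ R3 R4)
  have d1 : ∀ j, HasFDerivAt (fun z : R3 × R4 => z.1 j) (p1 j) 0 := fun j => (p1 j).hasFDerivAt
  have d2 : ∀ j, HasFDerivAt (fun z : R3 × R4 => z.2 j) (p2 j) 0 := fun j => (p2 j).hasFDerivAt
  have c2 : HasFDerivAt (fun z : R3 × R4 => z.2 2 - z.2 3^4) (p2 2) 0 := by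
    exact ((d2 2).sub ((d2 3).pow 4)).congr_fderiv (by simp)
  have c1 : HasFDerivAt (fun z : R3 × R4 => z.2 1 + 4 * z.2 3^3) (p2 1) 0 := by
    exact ((d2 1).add (((d2 3).pow 3).const_mul 4)).congr_fderiv (by simp)
  have c0 : HasFDerivAt (fun z : R3 × R4 => z.2 0 - 6 * z.2 3^2) (p2 0) 0 := by
    exact ((d2 0).sub (((d2 3).pow 2).const_mul 6)).congr_fderiv (by simp)
  have c3 : HasFDerivAt (fun z : R3 × R4 => 4 * z.2 3) ((4:ℝ) • p2 3) 0 := (d2 3).const_mul 4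
  have ne : (∞ : WithTop ℕ∞) ≠ 0 := by simp
  have := ((((((hasFDerivAt_smul_zero (d1 0) rfl (n0.differentiable ne 0)).add
    (hasFDerivAt_smul_zero (d1 1) rfl (r1.differentiable ne 0))).add
    (hasFDerivAt_smul_zero (d1 2) rfl (l2.differentiable ne 0))).add
    (hasFDerivAt_smul_zero c2 (by simp) (k0.differentiable ne 0))).add
    (hasFDerivAt_smul_zero c1 (by simp) (k1.differentiable ne 0))).add
    (hasFDerivAt_smul_zero c0 (by simp) (k2.differentiable ne 0))).add
    (hasFDerivAt_smul_zero c3 (by simp) (k3.differentiable ne 0))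
  have hh : HasFDerivAt (Psi Rn R1 Rl Rk) _ 0 := this
  rw [hh.fderiv]
  rfl

end

end

section
open Filter Topology Set
open scoped ContDiff
open MeasureTheory

theorem hadamard_pow {F : Type} [NormedAddCommGroup F] [NormedSpace ℝ F] [CompleteSpace F] (n : ℕ)
    (h g : ℝ → F) (hg : ContDiff ℝ ∞ g) (hh : ∀ᶠ t in 𝓝 (0:ℝ), HasDerivAt h (t^n • g t) t) :
    ∃ k : ℝ → F, ContDiff ℝ ∞ k ∧ k 0 = (1/((n:ℝ)+1)) • g 0 ∧
      ∀ᶠ t in 𝓝 (0:ℝ), h t = h 0 + t^(n+1) • k t := by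
  obtain ⟨g', hg', heq⟩ := exists_cutoff g hg
  obtain ⟨r, hr, hh⟩ := Metric.eventually_nhds_iff_ball.1 hh
  let G : ℝ × ℝ → F := fun q => g' (q.1 * q.2)
  have h1 : Function.HasTemperateGrowth (fun p : ℝ × ℝ => p.1) :=
    (ContinuousLinearMap.fst ℝ ℝ ℝ).hasTemperateGrowth
  have h2 : Function.HasTemperateGrowth (fun p : ℝ × ℝ => p.2) :=
    (ContinuousLinearMap.snd ℝ ℝ ℝ).hasTemperateGrowth
  have hG : G.HasTemperateGrowth := hg'.comp (h1.mul h2)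
  have hs := param_smooth (μ := volume.restrict (Ioc (0:ℝ) 1)) (w := fun s => s^n) (p := fun s : ℝ => s)
    (by fun_prop) aestronglyMeasurable_id (by
      intro M
      have : Continuous (fun s : ℝ => |s^n| * (1+‖s‖)^M) := by fun_prop
      exact (this.integrableOn_Icc (a := 0) (b := 1)).mono_set Ioc_subset_Icc_self) F G hG
  refine ⟨_, hs, ?_, ?_⟩
  · simp only [G, zero_mul]
    rw [integral_smul_const, ← intervalIntegral.integral_of_le zero_le_one, integral_pow,
      heq 0 (by simp)]
    simp
  · filter_upwards [Metric.ball_mem_nhds (0:ℝ) (lt_min hr one_pos)] with t ht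
    have ht' : |t| < min r 1 := by simpa using ht
    have hts : ∀ s ∈ uIcc (0:ℝ) 1, |t * s| < min r 1 := by
      intro s hs
      rw [uIcc_of_le zero_le_one] at hs
      rw [abs_mul, abs_of_nonneg hs.1]
      calc |t| * s ≤ |t| * 1 := by gcongr; exact hs.2
        _ < _ := by simpa using ht'
    have hd : ∀ s ∈ uIcc (0:ℝ) 1,
        HasDerivAt (fun s => h (t*s)) (t^(n+1) • (s^n • g' (t*s))) s := by
      intro s hs
      have h1 : HasDerivAt h ((t*s)^n • g (t*s)) (t*s) := hh _ (by
        simpa using (hts s hs).trans_le (min_le_left _ _))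
      have h2 : HasDerivAt (fun s => t*s) t s := by simpa using (hasDerivAt_id s).const_mul t
      have h3 := h1.scomp s h2
      refine h3.congr_deriv ?_
      rw [heq _ ((hts s hs).trans_le (min_le_right _ _)).le, smul_smul, smul_smul]
      congr 1; ring
    have hc : Continuous (fun s => t^(n+1) • (s^n • g' (t*s))) := by
      have := hg'.1.continuous
      fun_prop
    have := intervalIntegral.integral_eq_sub_of_hasDerivAt (a := 0) (b := 1) hd
      (hc.intervalIntegrable _ _)
    rw [intervalIntegral.integral_of_le zero_le_one, integral_smul] at this
    simp only [G, this]
    simp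

end

section
open Filter Topology Set
open scoped ContDiff

/-- first three coordinates -/
def pr3 : R4 →L[ℝ] R3 := ContinuousLinearMap.pi fun j =>
  ContinuousLinearMap.proj (R := ℝ) (φ := fun _ : Fin 4 => ℝ) (j.castSucc)

theorem pr3_apply (z : R4) : pr3 z = ![z 0, z 1, z 2] := by
  ext j; fin_cases j <;> rfl

/-- the model wave front point -/
def wPt (x H : ℝ) : R3 := ![H-2*x^2, -2*x*H, x^2*(x^2+H)]

theorem Interp.psi {Rn R1 Rl Rk : R4 → R4} {x H e n n' a a' l l' k k' : ℝ} (Y : R3)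
    (hn : Interp (Rn (swPt x H e)) x n n') (h1 : Interp (R1 (swPt x H e)) x a a')
    (hl : Interp (Rl (swPt x H e)) x l l') (hk : Interp (Rk (swPt x H e)) x k k') :
    Interp (Psi Rn R1 Rl Rk (Y, swPt x H e)) x
      (Y 0 * n + Y 1 * ((x-e)*a) + Y 2 * ((x-e)^2*l) - (x-e)^4*k)
      (Y 0 * n' + Y 1 * (a+(x-e)*a') + Y 2 * (2*(x-e)*l+(x-e)^2*l')
        - (4*(x-e)^3*k+(x-e)^4*k')) := by
  have e3 : swPt x H e 3 = e := rfl
  have e2 : swPt x H e 2 = x^2*(x^2+H) := rfl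
  have e1 : swPt x H e 1 = -2*x*H := rfl
  have e0 : swPt x H e 0 = H-2*x^2 := rfl
  have k1 := hk.mulE H 0 e
  have k2 := k1.mulE H 0 e
  have k3 := k2.mulE H 0 e
  have := ((((((hn.smul (Y 0)).add ((h1.mulE H e e).smul (Y 1))).add
    (((hl.mulE H e e).mulE H e e).smul (Y 2))).add (hk.smul (x^2*(x^2+H)-e^4))).add
    (k1.smul (-2*x*H+4*e^3))).add (k2.smul (H-2*x^2-6*e^2))).add (k3.smul (4*e))
  unfold Psi
  simp only [e0,e1,e2,e3]
  convert! this using 1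
  · ring
  · ring

theorem psi_inj {Rn R1 Rl Rk : R4 → R4} (hRn : ContDiff ℝ ∞ Rn) (hR1 : ContDiff ℝ ∞ R1)
    (hRl : ContDiff ℝ ∞ Rl) (hRk : ContDiff ℝ ∞ Rk) (n0 : Rn 0 0 ≠ 0) (n1 : R1 0 0 ≠ 0)
    (n2 : Rl 0 0 ≠ 0) (n3 : Rk 0 0 ≠ 0) (v : R3 × R4)
    (hv : fderiv ℝ (Psi Rn R1 Rl Rk) 0 v = 0) (h : v.1 = 0 ∨ pr3 v.2 = 0) : v = 0 := by
  rw [Psi_fderiv hRn hR1 hRl hRk] at hv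
  have c0 := congrFun hv 0
  have c1 := congrFun hv 1
  have c2 := congrFun hv 2
  have c3 := congrFun hv 3
  simp [mulE] at c0 c1 c2 c3
  rcases h with h | h
  · have y0 := congrFun h 0
    have y1 := congrFun h 1
    have y2 := congrFun h 2
    simp at y0 y1 y2
    simp only [y0, y1, y2, zero_mul, zero_add] at c0 c1 c2 c3
    have a2 : v.2 2 = 0 := by simpa [n3, Matrix.vecHead] using c0
    simp only [a2, zero_mul, zero_add] at c1 c2 c3
    have a1 : v.2 1 = 0 := by simpa [n3] using c1
    simp only [a1, zero_mul, zero_add] at c2 c3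
    have a0 : v.2 0 = 0 := by simpa [n3] using c2
    simp only [a0, zero_mul, zero_add] at c3
    have a3 : v.2 3 = 0 := by simpa [n3] using c3
    apply Prod.ext
    · exact h
    · ext j; fin_cases j <;> simp [a0,a1,a2,a3]
  · rw [pr3_apply] at h
    have a0 := congrFun h 0
    have a1 := congrFun h 1
    have a2 := congrFun h 2
    simp at a0 a1 a2
    simp only [a0, a1, a2, zero_mul, add_zero] at c0 c1 c2 c3
    have y0 : v.1 0 = 0 := by simpa [n0, Matrix.vecHead] using c0
    simp only [y0, zero_mul, zero_add] at c1 c2 c3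
    have y1 : v.1 1 = 0 := by simpa [n1] using c1
    simp only [y1, zero_mul, zero_add] at c2 c3
    have y2 : v.1 2 = 0 := by simpa [n2] using c2
    simp only [y2, zero_mul, zero_add] at c3
    have a3 : v.2 3 = 0 := by simpa [n3] using c3
    apply Prod.ext
    · ext j; fin_cases j <;> simp [y0,y1,y2]
    · ext j; fin_cases j <;> simp [a0,a1,a2,a3]

theorem abs_main (n0 l1 l k : ℝ → ℝ) (hn : ContDiff ℝ ∞ n0) (h1 : ContDiff ℝ ∞ l1)
    (hl : ContDiff ℝ ∞ l) (hk : ContDiff ℝ ∞ k) (zn : n0 0 ≠ 0) (z1 : l1 0 ≠ 0) (zl : l 0 ≠ 0)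
    (zk : k 0 ≠ 0) :
    ∃ (τ τi : R3 → R3) (ee : R3 → ℝ), τ 0 = 0 ∧ τi 0 = 0 ∧ ee 0 = 0 ∧
      ContDiffAt ℝ ∞ τ 0 ∧ ContDiffAt ℝ ∞ τi 0 ∧ ContDiffAt ℝ ∞ ee 0 ∧
      (∀ᶠ w in 𝓝 0, τ (τi w) = w) ∧ (∀ᶠ y in 𝓝 0, τi (τ y) = y) ∧
      ∀ᶠ q : ℝ × ℝ in 𝓝 0, ∀ t, t = q.1 - ee (wPt q.1 q.2) → ∀ Y, Y = τi (wPt q.1 q.2) →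
        (Y 0 * n0 t + Y 1 * (t*l1 t) + Y 2 * (t^2*l t) - t^4*k t = 0) ∧
        Y 0 * deriv n0 t + Y 1 * (l1 t+t*deriv l1 t) + Y 2 * (2*t*l t+t^2*deriv l t)
        - (4*t^3*k t+t^4*deriv k t) = 0 := by
  obtain ⟨Rn, hRn, η0, p0, in0⟩ := crux n0 hn
  obtain ⟨R1, hR1, η1, p1, in1⟩ := crux l1 h1
  obtain ⟨Rl, hRl, η2, p2, in2⟩ := crux l hl
  obtain ⟨Rk, hRk, η3, p3, in3⟩ := crux k hk
  have sw0 : swPt 0 0 0 = 0 := by ext j; fin_cases j <;> simp [swPt]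
  have val : ∀ (R : R4 → R4) (m : ℝ → ℝ), Interp (R (swPt 0 0 0)) 0 (m (0-0)) (deriv m (0-0)) →
      R 0 0 = m 0 := by
    intro R m h
    have := h.1
    rw [sw0] at this
    simpa using this
  have vn : Rn 0 0 ≠ 0 := by rw [val Rn n0 (in0 0 0 0 (by simpa using p0))]; exact zn
  have v1 : R1 0 0 ≠ 0 := by rw [val R1 l1 (in1 0 0 0 (by simpa using p1))]; exact z1
  have v2 : Rl 0 0 ≠ 0 := by rw [val Rl l (in2 0 0 0 (by simpa using p2))]; exact zl
  have v3 : Rk 0 0 ≠ 0 := by rw [val Rk k (in3 0 0 0 (by simpa using p3))]; exact zk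
  have hP := Psi_contDiff hRn hR1 hRl hRk
  have hPd : HasFDerivAt (Psi Rn R1 Rl Rk) (fderiv ℝ (Psi Rn R1 Rl Rk) 0) 0 :=
    (hP.differentiable (by simp) 0).hasFDerivAt
  have P0 : Psi Rn R1 Rl Rk 0 = 0 := by simp [Psi]
  let q3 : R3 × R4 →L[ℝ] R3 := pr3.comp (ContinuousLinearMap.snd ℝ R3 R4)
  let Φ1 : R3 × R4 → R3 × R4 := fun z => (q3 z, Psi Rn R1 Rl Rk z)
  let Φ2 : R3 × R4 → R3 × R4 := fun z => (z.1, Psi Rn R1 Rl Rk z)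
  have Φ10 : Φ1 0 = 0 := Prod.ext (map_zero _) P0
  have Φ20 : Φ2 0 = 0 := Prod.ext rfl P0
  have cd1 : ContDiff ℝ ∞ Φ1 := q3.contDiff.prodMk hP
  have cd2 : ContDiff ℝ ∞ Φ2 := contDiff_fst.prodMk hP
  have fd1 : HasFDerivAt Φ1 (q3.prod (fderiv ℝ (Psi Rn R1 Rl Rk) 0)) 0 := q3.hasFDerivAt.prodMk hPd
  have fd2 : HasFDerivAt Φ2 ((ContinuousLinearMap.fst ℝ R3 R4).prod (fderiv ℝ (Psi Rn R1 Rl Rk) 0)) 0 :=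
    hasFDerivAt_fst.prodMk hPd
  obtain ⟨g1, g1s, g10, g1l, g1r⟩ := ift_wrap rfl Φ1 0 cd1.contDiffAt (by
    intro v hv
    rw [fd1.fderiv] at hv
    exact psi_inj hRn hR1 hRl hRk vn v1 v2 v3 v (congrArg Prod.snd hv) (Or.inr (congrArg Prod.fst hv)))
  obtain ⟨g2, g2s, g20, g2l, g2r⟩ := ift_wrap rfl Φ2 0 cd2.contDiffAt (by
    intro v hv
    rw [fd2.fderiv] at hv
    exact psi_inj hRn hR1 hRl hRk vn v1 v2 v3 v (congrArg Prod.snd hv) (Or.inl (congrArg Prod.fst hv)))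
  rw [Φ10] at g1s g10 g1r
  rw [Φ20] at g2s g20 g2r
  let ι : R3 → R3 × R4 := fun w => (w, 0)
  have hι : ContDiff ℝ ∞ ι := contDiff_id.prodMk contDiff_const
  have ι0 : ι 0 = 0 := rfl
  have G1s : ContDiffAt ℝ ∞ (fun w => g1 (ι w)) 0 := ContDiffAt.comp (0:R3) g1s hι.contDiffAt
  have G2s : ContDiffAt ℝ ∞ (fun w => g2 (ι w)) 0 := ContDiffAt.comp (0:R3) g2s hι.contDiffAt
  have tι : Tendsto ι (𝓝 0) (𝓝 0) := hι.continuous.tendsto' 0 0 ι0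
  have t1 : Tendsto (fun w => g1 (ι w)) (𝓝 0) (𝓝 0) := by
    have := G1s.continuousAt.tendsto
    rwa [ι0, g10] at this
  have t2 : Tendsto (fun w => g2 (ι w)) (𝓝 0) (𝓝 0) := by
    have := G2s.continuousAt.tendsto
    rwa [ι0, g20] at this
  have ees : ContDiffAt ℝ ∞ (fun w => (g1 (ι w)).2 3) 0 :=
    contDiffAt_pi.1 (contDiffAt_snd.comp (0:R3) G1s) 3
  refine ⟨fun y => pr3 (g2 (ι y)).2, fun w => (g1 (ι w)).1, fun w => (g1 (ι w)).2 3, ?_, ?_, ?_, ?_, ?_, ?_, ?_, ?_, ?_⟩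
  · simp [ι0, g20]
  · simp [ι0, g10]
  · simp [ι0, g10]
  · exact pr3.contDiff.contDiffAt.comp (0:R3) (contDiffAt_snd.comp (0:R3) G2s)
  · exact contDiffAt_fst.comp (0:R3) G1s
  · exact ees
  · filter_upwards [tι.eventually g1r, t1.eventually g2l] with w hw1 hw2
    have e1 : q3 (g1 (ι w)) = w := congrArg Prod.fst hw1
    have e2 : Psi Rn R1 Rl Rk (g1 (ι w)) = 0 := congrArg Prod.snd hw1
    have e3 : Φ2 (g1 (ι w)) = ι (g1 (ι w)).1 := Prod.ext rfl e2
    rw [e3] at hw2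
    simp only [hw2]
    exact e1
  · filter_upwards [tι.eventually g2r, t2.eventually g1l] with w hw1 hw2
    have e1 : (g2 (ι w)).1 = w := congrArg Prod.fst hw1
    have e2 : Psi Rn R1 Rl Rk (g2 (ι w)) = 0 := congrArg Prod.snd hw1
    have e3 : Φ1 (g2 (ι w)) = ι (pr3 (g2 (ι w)).2) := Prod.ext rfl e2
    rw [e3] at hw2
    simp only [hw2]
    exact e1
  · have hwc : Continuous (fun q : ℝ × ℝ => wPt q.1 q.2) := by
      refine continuous_pi fun j => ?_
      fin_cases j <;> simp [wPt] <;> fun_prop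
    have w0 : wPt (0:ℝ×ℝ).1 (0:ℝ×ℝ).2 = 0 := by ext j; fin_cases j <;> simp [wPt]
    have tw : Tendsto (fun q : ℝ × ℝ => wPt q.1 q.2) (𝓝 0) (𝓝 0) := hwc.tendsto' 0 0 w0
    have te : Tendsto (fun q : ℝ × ℝ => |q.1 - (g1 (ι (wPt q.1 q.2))).2 3|) (𝓝 0) (𝓝 0) := by
      have a1 : Tendsto (fun w : R3 => (g1 (ι w)).2 3) (𝓝 0) (𝓝 0) := by
        have := ees.continuousAt.tendsto
        simpa [ι0, g10] using this
      have a2 : Tendsto (fun q : ℝ × ℝ => q.1) (𝓝 0) (𝓝 0) := continuous_fst.tendsto' 0 0 rfl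
      simpa using (a2.sub (a1.comp tw)).abs
    filter_upwards [(tι.comp tw).eventually g1r, te.eventually_lt_const p0,
      te.eventually_lt_const p1, te.eventually_lt_const p2, te.eventually_lt_const p3]
      with q hq b0 b1 b2 b3 t ht Y hY
    have e1 : q3 (g1 (ι (wPt q.1 q.2))) = wPt q.1 q.2 := congrArg Prod.fst hq
    have e2 : Psi Rn R1 Rl Rk (g1 (ι (wPt q.1 q.2))) = 0 := congrArg Prod.snd hq
    have e3 : (g1 (ι (wPt q.1 q.2))) = (Y, swPt q.1 q.2 ((g1 (ι (wPt q.1 q.2))).2 3)) := by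
      refine Prod.ext hY.symm ?_
      ext j
      fin_cases j
      · exact congrFun e1 0
      · exact congrFun e1 1
      · exact congrFun e1 2
      · rfl
    have key := Interp.psi Y (in0 _ q.2 _ b0) (in1 _ q.2 _ b1) (in2 _ q.2 _ b2) (in3 _ q.2 _ b3)
    rw [← e3, e2, ← ht] at key
    obtain ⟨ka, kb⟩ := key
    simp at ka kb
    exact ⟨ka.symm, by linear_combination -kb⟩

end

section
open Filter Topology Set
open scoped ContDiff

/-- the three by three determinant -/
def det3 (a b c : R3) : ℝ :=
  a 0 * (b 1 * c 2 - b 2 * c 1) - a 1 * (b 0 * c 2 - b 2 * c 0) + a 2 * (b 0 * c 1 - b 1 * c 0)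

theorem det3_contDiffAt {E : Type} [NormedAddCommGroup E] [NormedSpace ℝ E] {a b c : E → R3} {x : E}
    (ha : ContDiffAt ℝ ∞ a x) (hb : ContDiffAt ℝ ∞ b x) (hc : ContDiffAt ℝ ∞ c x) :
    ContDiffAt ℝ ∞ (fun t => det3 (a t) (b t) (c t)) x := by
  have a' := fun i => contDiffAt_pi.1 ha i
  have b' := fun i => contDiffAt_pi.1 hb i
  have c' := fun i => contDiffAt_pi.1 hc i
  unfold det3
  exact (((a' 0).mul (((b' 1).mul (c' 2)).sub ((b' 2).mul (c' 1)))).sub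
    ((a' 1).mul (((b' 0).mul (c' 2)).sub ((b' 2).mul (c' 0))))).add
    ((a' 2).mul (((b' 0).mul (c' 1)).sub ((b' 1).mul (c' 0))))

theorem det3_contDiff {E : Type} [NormedAddCommGroup E] [NormedSpace ℝ E] {a b c : E → R3}
    (ha : ContDiff ℝ ∞ a) (hb : ContDiff ℝ ∞ b) (hc : ContDiff ℝ ∞ c) :
    ContDiff ℝ ∞ (fun t => det3 (a t) (b t) (c t)) :=
  contDiff_iff_contDiffAt.2 fun _ => det3_contDiffAt ha.contDiffAt hb.contDiffAt hc.contDiffAt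

theorem det3_hasDerivAt {a b c : ℝ → R3} {a' b' c' : R3} {t : ℝ}
    (ha : HasDerivAt a a' t) (hb : HasDerivAt b b' t) (hc : HasDerivAt c c' t) :
    HasDerivAt (fun t => det3 (a t) (b t) (c t))
      (det3 a' (b t) (c t) + det3 (a t) b' (c t) + det3 (a t) (b t) c') t := by
  have a' := fun i => hasDerivAt_pi.1 ha i
  have b' := fun i => hasDerivAt_pi.1 hb i
  have c' := fun i => hasDerivAt_pi.1 hc i
  unfold det3
  refine ((((a' 0).mul (((b' 1).mul (c' 2)).sub ((b' 2).mul (c' 1)))).sub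
    ((a' 1).mul (((b' 0).mul (c' 2)).sub ((b' 2).mul (c' 0))))).add
    ((a' 2).mul (((b' 0).mul (c' 1)).sub ((b' 1).mul (c' 0))))).congr_deriv ?_
  simp
  ring

theorem det3_cramer {v a b c : R3} (h : det3 a b c ≠ 0) (h1 : det3 v a b = 0) (h2 : det3 v a c = 0) :
    v = (det3 v b c / det3 a b c) • a := by
  have key : det3 a b c • v = det3 v b c • a - det3 v a c • b + det3 v a b • c := by
    ext j; fin_cases j <;> simp [det3] <;> ring
  rw [h1, h2] at key
  rw [div_eq_inv_mul, mul_smul]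
  simp only [zero_smul, sub_zero, add_zero] at key
  rw [← key, smul_smul, inv_mul_cancel₀ h, one_smul]

theorem smooth_deriv {F : Type} [NormedAddCommGroup F] [NormedSpace ℝ F] {g : ℝ → F}
    (hg : ContDiff ℝ ∞ g) : ContDiff ℝ ∞ (deriv g) :=
  (contDiff_infty_iff_deriv.1 hg).2

theorem smooth_hasDerivAt {F : Type} [NormedAddCommGroup F] [NormedSpace ℝ F] {g : ℝ → F}
    (hg : ContDiff ℝ ∞ g) (t : ℝ) : HasDerivAt g (deriv g t) t :=
  (hg.differentiable (by simp) t).hasDerivAt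

theorem geom (γ δ : ℝ → R3) (hγ : ContDiff ℝ ∞ γ) (hδ : ContDiff ℝ ∞ δ)
    (hγδ : ∀ t : ℝ, deriv γ t = t • δ t)
    (hD : det3 (δ 0) (deriv δ 0) (deriv (deriv δ) 0) ≠ 0) :
    ∃ n0 l1 l k : ℝ → ℝ, ContDiff ℝ ∞ n0 ∧ ContDiff ℝ ∞ l1 ∧ ContDiff ℝ ∞ l ∧ ContDiff ℝ ∞ k ∧
      n0 0 ≠ 0 ∧ l1 0 ≠ 0 ∧ l 0 ≠ 0 ∧ k 0 ≠ 0 ∧ ∀ᶠ t in 𝓝 (0:ℝ), ∀ Y : R3,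
        det3 (γ 0 + Y 0 • deriv (deriv δ) 0 + Y 1 • deriv δ 0 + Y 2 • δ 0 - γ t) (δ t) (deriv δ t)
        = Y 0 * n0 t + Y 1 * (t*l1 t) + Y 2 * (t^2*l t) - t^4*k t := by
  set A := δ 0 with hA
  set B := deriv δ 0 with hB
  set C := deriv (deriv δ) 0 with hC
  have hδ' := smooth_deriv hδ
  have hδ'' := smooth_deriv hδ'
  obtain ⟨η, hη, η0, eη⟩ := hadamard (deriv δ) hδ'
  rw [← hC] at η0
  rw [← hB] at eη
  obtain ⟨ζ, hζ, ζ0, eζ⟩ := hadamard_pow 1 (fun t => δ t - t • B) η hη (by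
    filter_upwards [eη] with t ht
    have := (smooth_hasDerivAt hδ t).sub ((hasDerivAt_id t).smul_const B)
    refine this.congr_deriv ?_
    rw [ht]; simp)
  obtain ⟨ε, hε, ε0, eε⟩ := hadamard_pow 3
    (fun t => γ t - (t^2/2) • δ t + (t^3/6) • deriv δ t) (fun t => (1/6:ℝ) • deriv (deriv δ) t)
    (hδ''.const_smul _) (by
    refine Eventually.of_forall fun t => ?_
    have p2 : HasDerivAt (fun t : ℝ => t^2/2) t t :=
      ((hasDerivAt_pow 2 t).div_const 2).congr_deriv (by simp)
    have p3 : HasDerivAt (fun t : ℝ => t^3/6) (t^2/2) t :=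
      ((hasDerivAt_pow 3 t).div_const 6).congr_deriv (by simp; ring)
    have := ((smooth_hasDerivAt hγ t).sub (p2.smul (smooth_hasDerivAt hδ t))).add
      (p3.smul (smooth_hasDerivAt hδ' t))
    refine this.congr_deriv ?_
    rw [hγδ]
    module)
  rw [← hC] at ε0
  rw [η0] at ζ0
  refine ⟨fun t => det3 C (δ t) (deriv δ t), fun t => det3 B (δ t) (η t),
    fun t => det3 A (ζ t) B + det3 A B (η t) + t * det3 A (ζ t) (η t),
    fun t => det3 (ε t) (δ t) (deriv δ t), ?_, ?_, ?_, ?_, ?_, ?_, ?_, ?_, ?_⟩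
  · exact det3_contDiff contDiff_const hδ hδ'
  · exact det3_contDiff contDiff_const hδ hη
  · exact ((det3_contDiff contDiff_const hζ contDiff_const).add
      (det3_contDiff contDiff_const contDiff_const hη)).add
      (contDiff_id.mul (det3_contDiff contDiff_const hζ hη))
  · exact det3_contDiff hε hδ hδ'
  · beta_reduce; rw [← hA, ← hB]
    convert! hD using 1
    simp [det3]; ring
  · beta_reduce; rw [← hA, η0]
    convert! neg_ne_zero.2 hD using 1
    simp [det3]; ring
  · beta_reduce; rw [ζ0, η0]
    convert! div_ne_zero hD (two_ne_zero) using 1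
    simp [det3]; ring
  · beta_reduce; rw [ε0, ← hA, ← hB]
    convert! div_ne_zero hD (show (24:ℝ) ≠ 0 by norm_num) using 1
    simp [det3]; ring
  · filter_upwards [eη, eζ, eε] with t h1 h2 h3 Y
    have h2' : δ t = A + t • B + t^2 • ζ t := by
      simp only [zero_smul, sub_zero] at h2
      rw [← hA] at h2
      rw [add_right_comm, ← h2]; abel
    have h3' : γ t = γ 0 + (t^2/2) • δ t - (t^3/6) • deriv δ t + t^4 • ε t := by
      have : γ t - (t^2/2) • δ t + (t^3/6) • deriv δ t = γ 0 + t^4 • ε t := by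
        rw [h3]; simp
      rw [show γ t = (γ t - (t^2/2) • δ t + (t^3/6) • deriv δ t) + (t^2/2) • δ t - (t^3/6) • deriv δ t
        by abel, this]
      abel
    have e1 : det3 B (δ t) (deriv δ t) = t * det3 B (δ t) (η t) := by
      rw [h1]; simp [det3]; ring
    have e2 : det3 A (δ t) (deriv δ t) =
        t^2 * (det3 A (ζ t) B + det3 A B (η t) + t * det3 A (ζ t) (η t)) := by
      rw [h1, h2']; simp [det3]; ring
    have e3 : det3 (γ 0 - γ t) (δ t) (deriv δ t) = - t^4 * det3 (ε t) (δ t) (deriv δ t) := by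
      rw [h3']; simp [det3]; ring
    have lin : det3 (γ 0 + Y 0 • C + Y 1 • B + Y 2 • A - γ t) (δ t) (deriv δ t) =
        Y 0 * det3 C (δ t) (deriv δ t) + Y 1 * det3 B (δ t) (deriv δ t) +
        Y 2 * det3 A (δ t) (deriv δ t) + det3 (γ 0 - γ t) (δ t) (deriv δ t) := by
      simp [det3]; ring
    rw [lin, e1, e2, e3]; ring

theorem geom_deriv (γ δ : ℝ → R3) (hγ : ContDiff ℝ ∞ γ) (hδ : ContDiff ℝ ∞ δ)
    (hγδ : ∀ t : ℝ, deriv γ t = t • δ t) {n0 l1 l k : ℝ → ℝ} (hn : ContDiff ℝ ∞ n0)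
    (h1 : ContDiff ℝ ∞ l1) (hl : ContDiff ℝ ∞ l) (hk : ContDiff ℝ ∞ k) (X Y : R3) (t : ℝ)
    (h : ∀ᶠ t in 𝓝 t, det3 (X - γ t) (δ t) (deriv δ t)
        = Y 0 * n0 t + Y 1 * (t*l1 t) + Y 2 * (t^2*l t) - t^4*k t) :
    det3 (X - γ t) (δ t) (deriv (deriv δ) t) =
      Y 0 * deriv n0 t + Y 1 * (l1 t+t*deriv l1 t) + Y 2 * (2*t*l t+t^2*deriv l t)
        - (4*t^3*k t+t^4*deriv k t) := by
  have a := det3_hasDerivAt ((smooth_hasDerivAt hγ t).const_sub X) (smooth_hasDerivAt hδ t)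
    (smooth_hasDerivAt (smooth_deriv hδ) t)
  have b := (((smooth_hasDerivAt hn t).const_mul (Y 0)).add
    (((hasDerivAt_id t).mul (smooth_hasDerivAt h1 t)).const_mul (Y 1))).add
    (((hasDerivAt_pow 2 t).mul (smooth_hasDerivAt hl t)).const_mul (Y 2)) |>.sub
    ((hasDerivAt_pow 4 t).mul (smooth_hasDerivAt hk t))
  have c := (a.congr_of_eventuallyEq (EventuallyEq.symm h)).unique b
  rw [hγδ] at c
  have z1 : det3 (-(t • δ t)) (δ t) (deriv δ t) = 0 := by simp [det3]; ring
  have z2 : det3 (X - γ t) (deriv δ t) (deriv δ t) = 0 := by simp [det3]; ring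
  rw [z1, z2] at c
  simp at c
  linear_combination c

theorem geom_abs (γ δ : ℝ → R3) (hγ : ContDiff ℝ ∞ γ) (hδ : ContDiff ℝ ∞ δ)
    (hγδ : ∀ t : ℝ, deriv γ t = t • δ t)
    (hD : det3 (δ 0) (deriv δ 0) (deriv (deriv δ) 0) ≠ 0) :
    ∃ (τ τi : R3 → R3) (ee : R3 → ℝ), τ 0 = 0 ∧ τi 0 = 0 ∧ ee 0 = 0 ∧
      ContDiffAt ℝ ∞ τ 0 ∧ ContDiffAt ℝ ∞ τi 0 ∧ ContDiffAt ℝ ∞ ee 0 ∧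
      (∀ᶠ w in 𝓝 0, τ (τi w) = w) ∧ (∀ᶠ y in 𝓝 0, τi (τ y) = y) ∧
      ∀ᶠ q : ℝ × ℝ in 𝓝 0, ∀ t, t = q.1 - ee (wPt q.1 q.2) → ∀ Y, Y = τi (wPt q.1 q.2) →
        ∀ X, X = γ 0 + Y 0 • deriv (deriv δ) 0 + Y 1 • deriv δ 0 + Y 2 • δ 0 →
        X = γ t + (det3 (X - γ t) (deriv δ t) (deriv (deriv δ) t) /
          det3 (δ t) (deriv δ t) (deriv (deriv δ) t)) • δ t := by
  obtain ⟨n0, l1, l, k, hn, h1, hl, hk, zn, z1, zl, zk, hev⟩ := geom γ δ hγ hδ hγδ hD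
  obtain ⟨τ, τi, ee, a1, a2, a3, a4, a5, a6, a7, a8, a9⟩ := abs_main n0 l1 l k hn h1 hl hk zn z1 zl zk
  refine ⟨τ, τi, ee, a1, a2, a3, a4, a5, a6, a7, a8, ?_⟩
  have hwc : Continuous (fun q : ℝ × ℝ => wPt q.1 q.2) := by
    refine continuous_pi fun j => ?_
    fin_cases j <;> simp [wPt] <;> fun_prop
  have w0 : wPt (0:ℝ×ℝ).1 (0:ℝ×ℝ).2 = 0 := by ext j; fin_cases j <;> simp [wPt]
  have tw : Tendsto (fun q : ℝ × ℝ => wPt q.1 q.2) (𝓝 0) (𝓝 0) := hwc.tendsto' 0 0 w0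
  have te : Tendsto (fun q : ℝ × ℝ => q.1 - ee (wPt q.1 q.2)) (𝓝 0) (𝓝 0) := by
    have b1 := a6.continuousAt.tendsto
    rw [a3] at b1
    have b2 : Tendsto (fun q : ℝ × ℝ => q.1) (𝓝 0) (𝓝 0) := continuous_fst.tendsto' 0 0 rfl
    simpa using b2.sub (b1.comp tw)
  have hne : ∀ᶠ t in 𝓝 (0:ℝ), det3 (δ t) (deriv δ t) (deriv (deriv δ) t) ≠ 0 :=
    (det3_contDiff hδ (smooth_deriv hδ) (smooth_deriv (smooth_deriv hδ))).continuous.continuousAt.eventually_ne hD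
  filter_upwards [a9, te.eventually hne, te.eventually hev.eventually_nhds]
    with q hq q1 q2 t ht Y hY X hX
  obtain ⟨e1, e2⟩ := hq t ht Y hY
  rw [← ht] at q1 q2
  have q3 : ∀ᶠ t in 𝓝 t, det3 (X - γ t) (δ t) (deriv δ t)
        = Y 0 * n0 t + Y 1 * (t*l1 t) + Y 2 * (t^2*l t) - t^4*k t := by
    filter_upwards [q2] with s hs
    rw [hX]; exact hs Y
  have f1 := q3.self_of_nhds
  have f2 := geom_deriv γ δ hγ hδ hγδ hn h1 hl hk X Y t q3
  rw [e1] at f1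
  rw [e2] at f2
  rw [← det3_cramer q1 f1 f2]; abel

end

section
open Set
open scoped ContDiff

theorem det3_of_span (a b c : R3) (h : Module.finrank ℝ ↥(Submodule.span ℝ
    ({a, b, c} : Set (Fin 3 → ℝ))) = 3) : det3 a b c ≠ 0 := by
  have hl : LinearIndependent ℝ ![a, b, c] := by
    rw [linearIndependent_iff_card_eq_finrank_span]
    have : Set.range ![a, b, c] = ({a, b, c} : Set (Fin 3 → ℝ)) := by
      ext y
      simp [Matrix.range_cons]
      tauto
    rw [this, Set.finrank, h]; simp
  have h2 : LinearIndependent ℝ (Matrix.of ![a, b, c]).row := hl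
  rw [Matrix.linearIndependent_rows_iff_isUnit, Matrix.isUnit_iff_isUnit_det, isUnit_iff_ne_zero,
    Matrix.det_fin_three] at h2
  intro h3
  apply h2
  rw [← h3]
  simp [det3]; ring

theorem det3_of_hyp (γ δ : ℝ → R3) (hδ : ContDiff ℝ ∞ δ)
    (h4 : Module.finrank ℝ ↥(Submodule.span ℝ
      ({iteratedDeriv 2 γ 0, iteratedDeriv 3 γ 0, iteratedDeriv 4 γ 0} : Set (Fin 3 → ℝ))) = 3)
    (hδγ : ∀ t : ℝ, deriv γ t = t • δ t) :
    det3 (δ 0) (deriv δ 0) (deriv (deriv δ) 0) ≠ 0 := by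
  have hδ' := smooth_deriv hδ
  have hδ'' := smooth_deriv hδ'
  have e1 : deriv γ = fun t => t • δ t := funext hδγ
  have e2 : deriv (deriv γ) = fun t => δ t + t • deriv δ t := by
    rw [e1]; ext1 t
    exact (((hasDerivAt_id t).smul (smooth_hasDerivAt hδ t)).congr_deriv (by simp; abel)).deriv
  have e3 : deriv (deriv (deriv γ)) = fun t => (2:ℝ) • deriv δ t + t • deriv (deriv δ) t := by
    rw [e2]; ext1 t
    exact (((smooth_hasDerivAt hδ t).add
      ((hasDerivAt_id t).smul (smooth_hasDerivAt hδ' t))).congr_deriv (by simp; module)).deriv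
  have e4 : deriv (deriv (deriv (deriv γ))) =
      fun t => (3:ℝ) • deriv (deriv δ) t + t • deriv (deriv (deriv δ)) t := by
    rw [e3]; ext1 t
    exact ((((smooth_hasDerivAt hδ' t).const_smul (2:ℝ)).add
      ((hasDerivAt_id t).smul (smooth_hasDerivAt hδ'' t))).congr_deriv (by simp; module)).deriv
  have f2 : iteratedDeriv 2 γ 0 = δ 0 := by
    simp [iteratedDeriv_succ, iteratedDeriv_zero, e2]
  have f3 : iteratedDeriv 3 γ 0 = (2:ℝ) • deriv δ 0 := by
    simp [iteratedDeriv_succ, iteratedDeriv_zero, e3]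
  have f4 : iteratedDeriv 4 γ 0 = (3:ℝ) • deriv (deriv δ) 0 := by
    simp [iteratedDeriv_succ, iteratedDeriv_zero, e4]
  rw [f2, f3, f4] at h4
  intro h
  apply det3_of_span _ _ _ h4
  have : det3 (δ 0) ((2:ℝ) • deriv δ 0) ((3:ℝ) • deriv (deriv δ) 0) =
    6 * det3 (δ 0) (deriv δ 0) (deriv (deriv δ) 0) := by simp [det3]; ring
  rw [this, h, mul_zero]

theorem vec3_contDiffAt {E : Type} [NormedAddCommGroup E] [NormedSpace ℝ E] {a b c : E → ℝ} {x : E}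
    (ha : ContDiffAt ℝ ∞ a x) (hb : ContDiffAt ℝ ∞ b x) (hc : ContDiffAt ℝ ∞ c x) :
    ContDiffAt ℝ ∞ (fun t => (![a t, b t, c t] : R3)) x := by
  rw [contDiffAt_pi]
  intro i
  fin_cases i
  · exact ha
  · exact hb
  · exact hc

/-- the affine chart with frame `C, B, A` -/
noncomputable def chartP (O A B C : R3) (Y : R3) : R3 := O + Y 0 • C + Y 1 • B + Y 2 • A

noncomputable def chartPi (O A B C : R3) (X : R3) : R3 :=
  ![det3 (X - O) B A / det3 C B A, det3 C (X - O) A / det3 C B A, det3 C B (X - O) / det3 C B A]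

theorem chartP_left (O A B C Y : R3) (h : det3 C B A ≠ 0) :
    chartPi O A B C (chartP O A B C Y) = Y := by
  ext j
  fin_cases j
  · simp only [chartPi, chartP]
    rw [show ∀ a b c : ℝ, (![a,b,c] : R3) ((fun i => i) ⟨0, by decide⟩) = a from fun _ _ _ => rfl]
    rw [div_eq_iff h]; simp [det3]; ring
  · simp only [chartPi, chartP]
    rw [show ∀ a b c : ℝ, (![a,b,c] : R3) ((fun i => i) ⟨1, by decide⟩) = b from fun _ _ _ => rfl]
    rw [div_eq_iff h]; simp [det3]; ring
  · simp only [chartPi, chartP]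
    rw [show ∀ a b c : ℝ, (![a,b,c] : R3) ((fun i => i) ⟨2, by decide⟩) = c from fun _ _ _ => rfl]
    rw [div_eq_iff h]; simp [det3]; ring

theorem chartP_right (O A B C X : R3) (h : det3 C B A ≠ 0) :
    chartP O A B C (chartPi O A B C X) = X := by
  have key : det3 C B A • (X - O) = det3 (X - O) B A • C + det3 C (X - O) A • B
      + det3 C B (X - O) • A := by
    ext j; fin_cases j <;> simp [det3] <;> ring
  have k2 : X - O = (det3 C B A)⁻¹ • (det3 C B A • (X - O)) := by
    rw [smul_smul, inv_mul_cancel₀ h, one_smul]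
  rw [key] at k2
  have k3 : chartP O A B C (chartPi O A B C X) = O + (X - O) := by
    refine Eq.trans ?_ (congrArg (fun v => O + v) k2.symm)
    simp only [chartP, chartPi, Matrix.cons_val_zero, Matrix.cons_val_one, Matrix.cons_val,
      div_eq_inv_mul, mul_smul, smul_add]
    abel
  rw [k3]; abel

theorem chartP_contDiff (O A B C : R3) : ContDiff ℝ ∞ (chartP O A B C) := by
  unfold chartP
  fun_prop

theorem chartPi_contDiff (O A B C : R3) : ContDiff ℝ ∞ (chartPi O A B C) := by
  have hs : ContDiff ℝ ∞ (fun X : R3 => X - O) := contDiff_id.sub contDiff_const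
  refine contDiff_iff_contDiffAt.2 fun X => vec3_contDiffAt ?_ ?_ ?_
  · exact ((det3_contDiff hs contDiff_const contDiff_const).div_const _).contDiffAt
  · exact ((det3_contDiff contDiff_const hs contDiff_const).div_const _).contDiffAt
  · exact ((det3_contDiff contDiff_const contDiff_const hs).div_const _).contDiffAt

noncomputable def scL (y : R3) : R3 := ![2 * y 0, -4 * y 1, 4 * y 2]
noncomputable def scLi (y : R3) : R3 := ![y 0 / 2, - y 1 / 4, y 2 / 4]

theorem scL_contDiff : ContDiff ℝ ∞ scL :=
  contDiff_iff_contDiffAt.2 fun X => vec3_contDiffAt (by fun_prop) (by fun_prop) (by fun_prop)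
theorem scLi_contDiff : ContDiff ℝ ∞ scLi :=
  contDiff_iff_contDiffAt.2 fun X => vec3_contDiffAt (by fun_prop) (by fun_prop) (by fun_prop)
theorem scL_left (y : R3) : scLi (scL y) = y := by
  ext j; fin_cases j <;> simp [scL, scLi]
theorem scL_right (y : R3) : scL (scLi y) = y := by
  ext j; fin_cases j <;> simp [scL, scLi] <;> ring

/-- the swallowtail -/
noncomputable def swG (p : ℝ × ℝ) : R3 :=
  ![p.1, p.2 ^ 3 + p.1 * p.2, (3/4) * p.2 ^ 4 + (1/2) * p.1 * p.2 ^ 2]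

theorem swG_contDiff : ContDiff ℝ ∞ swG :=
  contDiff_iff_contDiffAt.2 fun X => vec3_contDiffAt (by fun_prop) (by fun_prop) (by fun_prop)

theorem scL_swG (p : ℝ × ℝ) : scL (swG p) = wPt p.2 (2 * p.1 + 2 * p.2^2) := by
  ext j; fin_cases j <;> simp [scL, swG, wPt] <;> ring

theorem germ_main (γ δ : ℝ → R3) (hγ : ContDiff ℝ ∞ γ) (hδ : ContDiff ℝ ∞ δ)
    (hγδ : ∀ t : ℝ, deriv γ t = t • δ t)
    (hD : det3 (δ 0) (deriv δ 0) (deriv (deriv δ) 0) ≠ 0) :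
    GermEquiv (fun p : ℝ × ℝ => γ p.2 + p.1 • δ p.2) (0 : ℝ × ℝ) swG 0 := by
  obtain ⟨τ, τi, ee, a1, a2, a3, a4, a5, a6, a7, a8, a9⟩ := geom_abs γ δ hγ hδ hγδ hD
  set A := δ 0 with hA
  set B := deriv δ 0 with hB
  set C := deriv (deriv δ) 0 with hC
  have hd : det3 C B A ≠ 0 := by
    convert! neg_ne_zero.2 hD using 1
    simp [det3]; ring
  set P := chartP (γ 0) A B C with hP
  set Q := chartPi (γ 0) A B C with hQ
  have PQ : ∀ X, P (Q X) = X := fun X => chartP_right _ _ _ _ _ hd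
  have QP : ∀ X, Q (P X) = X := fun X => chartP_left _ _ _ _ _ hd
  have Ps : ContDiff ℝ ∞ P := chartP_contDiff _ _ _ _
  have Qs : ContDiff ℝ ∞ Q := chartPi_contDiff _ _ _ _
  have P0 : P 0 = γ 0 := by simp [hP, chartP]
  have Q0 : Q (γ 0) = 0 := by rw [← P0, QP]
  have G0 : swG 0 = 0 := by ext j; fin_cases j <;> simp [swG]
  have L0 : scL 0 = 0 := by ext j; fin_cases j <;> simp [scL]
  have M0 : scLi 0 = 0 := by ext j; fin_cases j <;> simp [scLi]
  set f : ℝ × ℝ → R3 := fun p => γ p.2 + p.1 • δ p.2 with hf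
  have fs : ContDiff ℝ ∞ f :=
    (hγ.comp contDiff_snd).add (contDiff_fst.smul (hδ.comp contDiff_snd))
  have f0 : f 0 = γ 0 := by simp [hf]
  let T : R3 → R3 := fun X => scLi (τ (Q X))
  let S : R3 → R3 := fun y => P (τi (scL y))
  have T0 : T (γ 0) = 0 := by simp only [T, Q0, a1, M0]
  have S0 : S 0 = γ 0 := by simp only [S, L0, a2, P0]
  have τs : ContDiffAt ℝ ∞ (fun X => τ (Q X)) (γ 0) :=
    ContDiffAt.comp (γ 0) (by rw [Q0]; exact a4) Qs.contDiffAt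
  have Ts : ContDiffAt ℝ ∞ T (γ 0) := ContDiffAt.comp (γ 0) scLi_contDiff.contDiffAt τs
  have τis : ContDiffAt ℝ ∞ (fun y => τi (scL y)) 0 :=
    ContDiffAt.comp (0:R3) (by rw [L0]; exact a5) scL_contDiff.contDiffAt
  have Ss : ContDiffAt ℝ ∞ S 0 := ContDiffAt.comp (0:R3) Ps.contDiffAt τis
  have es : ContDiffAt ℝ ∞ (fun y => ee (scL y)) 0 :=
    ContDiffAt.comp (0:R3) (by rw [L0]; exact a6) scL_contDiff.contDiffAt
  have tQ : Tendsto Q (𝓝 (γ 0)) (𝓝 0) := Qs.continuous.tendsto' _ _ Q0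
  have tL : Tendsto scL (𝓝 0) (𝓝 0) := scL_contDiff.continuous.tendsto' _ _ L0
  have ST : ∀ᶠ z in 𝓝 (γ 0), S (T z) = z := by
    filter_upwards [tQ.eventually a8] with z hz
    simp only [S, T, scL_right, hz, PQ]
  have TS : ∀ᶠ w in 𝓝 (0:R3), T (S w) = w := by
    filter_upwards [tL.eventually a7] with z hz
    simp only [S, T, QP, hz, scL_left]
  -- the source coordinate change
  let tt : ℝ × ℝ → ℝ := fun p => p.2 - ee (scL (swG p))
  let X : ℝ × ℝ → R3 := fun p => S (swG p)
  let ss : ℝ × ℝ → ℝ := fun p => det3 (X p - γ (tt p)) (deriv δ (tt p)) (deriv (deriv δ) (tt p)) /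
    det3 (δ (tt p)) (deriv δ (tt p)) (deriv (deriv δ) (tt p))
  let φ : ℝ × ℝ → ℝ × ℝ := fun p => (ss p, tt p)
  have tt0 : tt 0 = 0 := by simp only [tt, G0, L0, a3]; simp
  have X0 : X 0 = γ 0 := by simp only [X, G0, S0]
  have ss0 : ss 0 = 0 := by
    simp only [ss, tt0, X0, sub_self]
    simp [det3]
  have φ0 : φ 0 = 0 := Prod.ext ss0 tt0
  have Xs : ContDiffAt ℝ ∞ X 0 :=
    ContDiffAt.comp (g := S) (0:ℝ×ℝ) (by rw [G0]; exact Ss) swG_contDiff.contDiffAt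
  have tts : ContDiffAt ℝ ∞ tt 0 :=
    contDiffAt_snd.sub (ContDiffAt.comp (g := fun y => ee (scL y)) (0:ℝ×ℝ) (by rw [G0]; exact es)
      swG_contDiff.contDiffAt)
  have hδ' := smooth_deriv hδ
  have hδ'' := smooth_deriv hδ'
  have sss : ContDiffAt ℝ ∞ ss 0 := by
    have c1 : ContDiffAt ℝ ∞ (fun p => γ (tt p)) 0 := hγ.contDiffAt.comp (0:ℝ×ℝ) tts
    have c2 : ContDiffAt ℝ ∞ (fun p => δ (tt p)) 0 := hδ.contDiffAt.comp (0:ℝ×ℝ) tts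
    have c3 : ContDiffAt ℝ ∞ (fun p => deriv δ (tt p)) 0 := hδ'.contDiffAt.comp (0:ℝ×ℝ) tts
    have c4 : ContDiffAt ℝ ∞ (fun p => deriv (deriv δ) (tt p)) 0 := hδ''.contDiffAt.comp (0:ℝ×ℝ) tts
    exact (det3_contDiffAt (Xs.sub c1) c3 c4).div (det3_contDiffAt c2 c3 c4)
      (by rw [tt0]; exact hD)
  have φs : ContDiffAt ℝ ∞ φ 0 := sss.prodMk tts
  have tG : Tendsto swG (𝓝 0) (𝓝 0) := swG_contDiff.continuous.tendsto' _ _ G0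
  have tφ : Tendsto φ (𝓝 0) (𝓝 0) := by
    have := φs.continuousAt.tendsto
    rwa [φ0] at this
  have tq : Tendsto (fun p : ℝ × ℝ => (p.2, 2 * p.1 + 2 * p.2^2)) (𝓝 0) (𝓝 0) :=
    Continuous.tendsto' (by fun_prop) _ _ (by simp)
  have fφ : ∀ᶠ p in 𝓝 (0:ℝ×ℝ), f (φ p) = S (swG p) := by
    filter_upwards [tq.eventually a9] with p hp
    have := hp (tt p) (by simp only [tt, scL_swG]) (τi (scL (swG p))) (by rw [scL_swG]) (X p) rfl
    exact this.symm
  have gT : ∀ᶠ p in 𝓝 (0:ℝ×ℝ), T (f (φ p)) = swG p := by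
    filter_upwards [fφ, tG.eventually TS] with p h1 h2
    rw [h1, h2]
  -- an explicit left inverse
  let Θ : ℝ × ℝ → ℝ × ℝ := fun q => (T (f q) 0, q.2 + ee (scL (T (f q))))
  have Tfs : ContDiffAt ℝ ∞ (fun q => T (f q)) 0 :=
    ContDiffAt.comp (g := T) (0:ℝ×ℝ) (by rw [f0]; exact Ts) fs.contDiffAt
  have Θs : ContDiffAt ℝ ∞ Θ 0 :=
    (contDiffAt_pi.1 Tfs 0).prodMk (contDiffAt_snd.add
      (ContDiffAt.comp (g := fun y => ee (scL y)) (0:ℝ×ℝ) (by rw [f0, T0]; exact es) Tfs))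
  have Θφ : ∀ᶠ p in 𝓝 (0:ℝ×ℝ), Θ (φ p) = p := by
    filter_upwards [gT] with p hp
    refine Prod.ext ?_ ?_
    · simp only [Θ, hp]; rfl
    · simp only [Θ, hp]; simp only [φ, tt]; ring
  have ne : (∞ : WithTop ℕ∞) ≠ 0 := by simp
  obtain ⟨σ, σs, σ0, σl, σr⟩ := ift_wrap rfl φ 0 φs (by
    intro v hv
    have d1 : HasFDerivAt Θ (fderiv ℝ Θ (φ 0)) (φ 0) := by
      rw [φ0]; exact (Θs.differentiableAt ne).hasFDerivAt
    have d2 := d1.comp 0 (φs.differentiableAt ne).hasFDerivAt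
    have d3 : HasFDerivAt (Θ ∘ φ) (ContinuousLinearMap.id ℝ (ℝ×ℝ)) 0 :=
      (hasFDerivAt_id (0:ℝ×ℝ)).congr_of_eventuallyEq Θφ
    have d4 := congrArg (fun L => L v) (d3.unique d2)
    simp [hv] at d4
    exact d4)
  rw [φ0] at σs σ0 σr
  have tσ : Tendsto σ (𝓝 0) (𝓝 0) := by
    have := σs.continuousAt.tendsto
    rwa [σ0] at this
  refine ⟨σ, φ, T, S, σ0, ?_, σs, φs, ?_, ?_, σr, σl, ?_, ?_, ?_⟩
  · rw [f0, T0, G0]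
  · rw [f0]; exact Ts
  · rw [G0]; exact Ss
  · rw [f0]; exact ST
  · rw [G0]; exact TS
  · filter_upwards [tσ.eventually gT, σr] with x h1 h2
    rw [← h1, h2]

end

/-- The tangent variety to a curve `γ` of type `(2,3,4)` at `0` is locally diffeomorphic
to the swallowtail `(u, x) ↦ (u, x³ + ux, (3/4)x⁴ + (1/2)ux²)`. -/
theorem tangent_variety_type_234_swallowtail
    (γ δ : ℝ → Fin 3 → ℝ) (hγ : ContDiff ℝ (⊤ : ℕ∞) γ) (hδ : ContDiff ℝ (⊤ : ℕ∞) δ)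
    (h1 : deriv γ 0 = 0) (h2 : iteratedDeriv 2 γ 0 ≠ 0)
    (h3 : Module.finrank ℝ ↥(Submodule.span ℝ
      ({iteratedDeriv 2 γ 0, iteratedDeriv 3 γ 0} : Set (Fin 3 → ℝ))) = 2)
    (h4 : Module.finrank ℝ ↥(Submodule.span ℝ
      ({iteratedDeriv 2 γ 0, iteratedDeriv 3 γ 0, iteratedDeriv 4 γ 0} : Set (Fin 3 → ℝ))) = 3)
    (hδγ : ∀ t : ℝ, deriv γ t = t • δ t) :
    GermEquiv (fun p : ℝ × ℝ => γ p.2 + p.1 • δ p.2) (0 : ℝ × ℝ)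
      (fun p : ℝ × ℝ =>
        ![p.1, p.2 ^ 3 + p.1 * p.2, (3/4) * p.2 ^ 4 + (1/2) * p.1 * p.2 ^ 2]) (0 : ℝ × ℝ) := by
  exact germ_main γ δ hγ hδ hδγ (det3_of_hyp γ δ hδ h4 hδγ)
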